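/- arXiv:2506.17000 — 3 statements merged into one kernel-verified Lean document; each statement's English description precedes it below -/
import Mathlib

section
/- Let u be a Q-minimizer of J on Ω. There exists a constant C = C(n,p,m,Q) > 0 such that for all real numbers R ≥ T ≥ 1 with the closure of B_{R+1} contained in Ω, ( V_{R−T} )^{(n−1)/n} ≤ C · J(v_R, S_R), where V_{R−T} = |{x ∈ B_{R−T} : u(x) ≥ 0}|. -/
open MeasureTheory Metric Set

noncomputable section

/-- `v` is locally Lipschitz at every point of `Ω`. -/
def LocLipOn {n : ℕ} (Ω : Set (EuclideanSpace ℝ (Fin n)))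
    (v : EuclideanSpace ℝ (Fin n) → ℝ) : Prop :=
  ∀ x ∈ Ω, ∃ K : NNReal, ∃ U ∈ nhds x, LipschitzOnWith K v U

/-- The energy `J(v,A) = ∫_A (|∇v|^p + (1-v²)^m) dx`. -/
def Jpm {n : ℕ} (p m : ℝ) (v : EuclideanSpace ℝ (Fin n) → ℝ)
    (A : Set (EuclideanSpace ℝ (Fin n))) : ℝ :=
  ∫ x in A, (‖gradient v x‖ ^ p + (1 - (v x) ^ 2) ^ m)

/-- `u` is a `Q`-minimizer of `Jpm p m` in `Ω`. -/
def IsQMinOfJpm {n : ℕ} (p m Q : ℝ) (Ω : Set (EuclideanSpace ℝ (Fin n)))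
    (u : EuclideanSpace ℝ (Fin n) → ℝ) : Prop :=
  ∀ Ω' : Set (EuclideanSpace ℝ (Fin n)), IsOpen Ω' → Bornology.IsBounded Ω' →
    closure Ω' ⊆ Ω →
    ∀ v : EuclideanSpace ℝ (Fin n) → ℝ,
      (∀ x, v x ∈ Icc (-1 : ℝ) 1) → LocLipOn Ω v →
      (∀ x ∈ Ω \ Ω', v x = u x) →
      Jpm p m u Ω' ≤ Q * Jpm p m v Ω'

/-- The one-dimensional profile `U(t) = t` for `t ≥ 0` and
`U(t) = -1 + (1-t)^(-p/(m-p))` for `t ≤ 0`. -/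
def Uprof (p m : ℝ) (t : ℝ) : ℝ :=
  if 0 ≤ t then t else -1 + (1 - t) ^ (-(p / (m - p)))

/-- The radial competitor `v_R(x) = U(|x| - R)`. -/
def vComp {n : ℕ} (p m R : ℝ) (x : EuclideanSpace ℝ (Fin n)) : ℝ :=
  Uprof p m (‖x‖ - R)

/-- `S_R = {x ∈ B_{R+1} : u(x) > v_R(x)}`. -/
def Sset {n : ℕ} (p m R : ℝ) (u : EuclideanSpace ℝ (Fin n) → ℝ) :
    Set (EuclideanSpace ℝ (Fin n)) :=
  {x ∈ ball (0 : EuclideanSpace ℝ (Fin n)) (R + 1) | vComp p m R x < u x}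

open Filter Topology Module
open scoped Convolution NNReal ENNReal ContDiff

lemma hasFDerivAt_normed_convolution {E : Type*} [NormedAddCommGroup E] [NormedSpace ℝ E]
    [FiniteDimensional ℝ E] [MeasurableSpace E] [BorelSpace E] (μ : Measure E) [μ.IsAddHaarMeasure]
    (ρ : ContDiffBump (0 : E)) {f : E → ℝ} {K : ℝ≥0} (hf : LipschitzWith K f) (x : E) :
    Integrable (fun t ↦ ρ.normed μ t • fderiv ℝ f (x - t)) μ ∧
    HasFDerivAt (ρ.normed μ ⋆[ContinuousLinearMap.lsmul ℝ ℝ, μ] f)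
      (∫ t, ρ.normed μ t • fderiv ℝ f (x - t) ∂μ) x := by
  have hcont : Continuous (ρ.normed μ) := ρ.contDiff_normed (n := 0) |>.continuous
  have hint : Integrable (ρ.normed μ) μ := ρ.integrable_normed
  refine hasFDerivAt_integral_of_dominated_loc_of_lip (bound := fun t ↦ ρ.normed μ t * K)
    (F := fun y t ↦ ρ.normed μ t • f (y - t)) (univ_mem : univ ∈ 𝓝 x)
    (Eventually.of_forall fun y ↦ ?_) ?_ ?_ ?_ ?_ ?_
  · exact (hcont.smul (hf.continuous.comp (by fun_prop))).aestronglyMeasurable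
  · have hcont' : Continuous fun t ↦ ρ.normed μ t • f (x - t) :=
      hcont.smul (hf.continuous.comp (by fun_prop))
    exact hcont'.integrable_of_hasCompactSupport ρ.hasCompactSupport_normed.smul_right
  · refine hcont.aestronglyMeasurable.smul ?_
    exact ((measurable_fderiv ℝ f).comp (measurable_const.sub measurable_id)).aestronglyMeasurable
  · refine Eventually.of_forall fun t ↦ ?_
    refine LipschitzWith.lipschitzOnWith (LipschitzWith.of_dist_le_mul fun y z ↦ ?_)
    have h1 := hf.dist_le_mul (y - t) (z - t)
    have h0 : 0 ≤ ρ.normed μ t := ρ.nonneg_normed t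
    simp only [dist_sub_right, Real.dist_eq] at h1
    simp only [Real.dist_eq, smul_eq_mul, ← mul_sub, abs_mul, Real.coe_nnabs, abs_of_nonneg h0,
      NNReal.abs_eq, mul_assoc]
    exact mul_le_mul_of_nonneg_left h1 h0
  · exact hint.mul_const _
  · have h := hf.ae_differentiableAt (μ := μ)
    have hq : Measure.QuasiMeasurePreserving (fun t ↦ x - t) μ μ :=
      quasiMeasurePreserving_sub_left μ x
    filter_upwards [hq.ae h] with t ht
    have := ht.hasFDerivAt.comp x ((hasFDerivAt_id x).sub_const t)
    exact (this.const_smul (ρ.normed μ t)).congr_fderiv (by simp)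

lemma eLpNorm_fderiv_normed_convolution_le {E : Type*} [NormedAddCommGroup E] [NormedSpace ℝ E]
    [FiniteDimensional ℝ E] [MeasurableSpace E] [BorelSpace E] (μ : Measure E) [μ.IsAddHaarMeasure]
    (ρ : ContDiffBump (0 : E)) {f : E → ℝ} {K : ℝ≥0} (hf : LipschitzWith K f) :
    eLpNorm (fderiv ℝ (ρ.normed μ ⋆[ContinuousLinearMap.lsmul ℝ ℝ, μ] f)) 1 μ ≤
      eLpNorm (fderiv ℝ f) 1 μ := by
  have hcont : Continuous (ρ.normed μ) := ρ.contDiff_normed (n := 0) |>.continuous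
  simp only [eLpNorm_one_eq_lintegral_enorm]
  have hm : Measurable (fun z ↦ ‖fderiv ℝ f z‖ₑ) := (measurable_fderiv ℝ f).enorm
  calc ∫⁻ x, ‖fderiv ℝ (ρ.normed μ ⋆[ContinuousLinearMap.lsmul ℝ ℝ, μ] f) x‖ₑ ∂μ
      ≤ ∫⁻ x, ∫⁻ t, ‖ρ.normed μ t‖ₑ * ‖fderiv ℝ f (x - t)‖ₑ ∂μ ∂μ := by
        refine lintegral_mono fun x ↦ ?_
        rw [(hasFDerivAt_normed_convolution μ ρ hf x).2.fderiv]
        refine (enorm_integral_le_lintegral_enorm _).trans_eq ?_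
        simp only [enorm_smul]
    _ = ∫⁻ t, ∫⁻ x, ‖ρ.normed μ t‖ₑ * ‖fderiv ℝ f (x - t)‖ₑ ∂μ ∂μ := by
        refine lintegral_lintegral_swap (Measurable.aemeasurable ?_)
        exact ((hcont.measurable.comp measurable_snd).enorm).mul
          (hm.comp (measurable_fst.sub measurable_snd))
    _ = ∫⁻ t, ‖ρ.normed μ t‖ₑ * ∫⁻ x, ‖fderiv ℝ f x‖ₑ ∂μ ∂μ := by
        refine lintegral_congr fun t ↦ ?_
        rw [lintegral_const_mul (‖ρ.normed μ t‖ₑ) (f := fun x ↦ ‖fderiv ℝ f (x - t)‖ₑ)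
            (hm.comp (measurable_id.sub_const t)),
          lintegral_sub_right_eq_self (fun z ↦ ‖fderiv ℝ f z‖ₑ)]
    _ = ∫⁻ x, ‖fderiv ℝ f x‖ₑ ∂μ := by
        rw [lintegral_mul_const _ hcont.measurable.enorm]
        have : ∫⁻ t, ‖ρ.normed μ t‖ₑ ∂μ = 1 := by
          have h : ∀ t, ‖ρ.normed μ t‖ₑ = ENNReal.ofReal (ρ.normed μ t) := fun t ↦
            Real.enorm_of_nonneg (ρ.nonneg_normed t)
          simp only [h]
          rw [← ofReal_integral_eq_lintegral_ofReal ρ.integrable_normed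
            (Eventually.of_forall ρ.nonneg_normed), ρ.integral_normed, ENNReal.ofReal_one]
        rw [this, one_mul]

/-- The Gagliardo-Nirenberg-Sobolev inequality with exponent `1` for compactly supported
Lipschitz functions. -/
lemma LipschitzWith.eLpNorm_le_eLpNorm_fderiv_one {E : Type*} [NormedAddCommGroup E]
    [NormedSpace ℝ E] [FiniteDimensional ℝ E] [MeasurableSpace E] [BorelSpace E]
    (μ : Measure E) [μ.IsAddHaarMeasure] {f : E → ℝ} {K : ℝ≥0} (hf : LipschitzWith K f)
    (hsupp : HasCompactSupport f) {q : ℝ≥0} (hq : NNReal.HolderConjugate (finrank ℝ E) q) :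
    eLpNorm f q μ ≤ eLpNormLESNormFDerivOneConst μ q * eLpNorm (fderiv ℝ f) 1 μ := by
  let ρ : ℕ → ContDiffBump (0 : E) := fun k ↦
    { rIn := 1 / ((k : ℝ) + 1) / 2
      rOut := 1 / ((k : ℝ) + 1)
      rIn_pos := by positivity
      rIn_lt_rOut := half_lt_self (by positivity) }
  have hlim : Tendsto (fun k ↦ (ρ k).rOut) atTop (𝓝 0) := tendsto_one_div_add_atTop_nhds_zero_nat
  let F : ℕ → E → ℝ := fun k ↦ (ρ k).normed μ ⋆[ContinuousLinearMap.lsmul ℝ ℝ, μ] f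
  have hsm : ∀ k, ContDiff ℝ 1 (F k) := fun k ↦
    (ρ k).hasCompactSupport_normed.contDiff_convolution_left _ (ρ k).contDiff_normed
      hf.continuous.locallyIntegrable
  have hFs : ∀ k, HasCompactSupport (F k) := fun k ↦
    (ρ k).hasCompactSupport_normed.convolution _ hsupp
  refine (Lp.eLpNorm_lim_le_liminf_eLpNorm (f := F)
    (fun k ↦ (hsm k).continuous.aestronglyMeasurable) f
    (Eventually.of_forall fun x ↦
      ContDiffBump.convolution_tendsto_right_of_continuous hlim hf.continuous x)).trans ?_
  refine liminf_le_of_le (by isBoundedDefault) fun b hb ↦ ?_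
  obtain ⟨k, hk⟩ := hb.exists
  refine hk.trans ((MeasureTheory.eLpNorm_le_eLpNorm_fderiv_one μ (hsm k) (hFs k) hq).trans ?_)
  gcongr
  exact eLpNorm_fderiv_normed_convolution_le μ (ρ k) hf


/-- The `1`-Lipschitz truncation of a real number to the interval `[c, 0]`. -/
def trunc (c t : ℝ) : ℝ := max c (min t 0)

lemma abs_trunc_sub_le (c s t : ℝ) : |trunc c s - trunc c t| ≤ |s - t| := by
  unfold trunc
  calc |max c (min s 0) - max c (min t 0)| ≤ |min s 0 - min t 0| := by
        rw [max_comm c, max_comm c]; exact abs_max_sub_max_le_abs _ _ _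
    _ ≤ |s - t| := by
        have := abs_min_sub_min_le_max s 0 t 0
        simpa using this

lemma trunc_mono (c : ℝ) : Monotone (trunc c) := fun _ _ h ↦
  max_le_max_left _ (min_le_min_right _ h)

lemma lipschitzWith_trunc (c : ℝ) : LipschitzWith 1 (trunc c) :=
  LipschitzWith.of_dist_le_mul fun s t ↦ by
    simpa [Real.dist_eq] using abs_trunc_sub_le c s t

/-- The energy density controls the local Lipschitz constant of a truncation. -/
lemma exists_local_lipschitz_trunc {E : Type*} [NormedAddCommGroup E] [NormedSpace ℝ E]
    {p m c : ℝ} (hp : 1 < p) (hpm : p < m) (hc : -1 < c) (hc0 : c < 0) {f : E → ℝ} {x : E}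
    (hf : DifferentiableAt ℝ f x) (h1 : -1 ≤ f x) (h2 : f x ≤ 1) :
    ∃ b, 0 ≤ b ∧ b ≤ (1 + 1 / (1 - c ^ 2) ^ m) * (‖fderiv ℝ f x‖ ^ p + (1 - (f x) ^ 2) ^ m) ∧
      ∀ ε > 0, ∀ᶠ y in 𝓝 x, |trunc c (f y) - trunc c (f x)| ≤ (b + ε) * ‖y - x‖ := by
  have hW : 0 ≤ (1 - (f x) ^ 2) ^ m := Real.rpow_nonneg (by nlinarith) _
  have hD : 0 ≤ ‖fderiv ℝ f x‖ ^ p := by positivity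
  by_cases hx : c ≤ f x ∧ f x ≤ 0
  · have hw0 : 0 < 1 - c ^ 2 := by nlinarith
    have hw : (1 - c ^ 2) ^ m ≤ (1 - (f x) ^ 2) ^ m :=
      Real.rpow_le_rpow hw0.le (by nlinarith) (by linarith)
    have hwp : 0 < (1 - c ^ 2) ^ m := Real.rpow_pos_of_pos hw0 _
    have hK : 1 ≤ 1 / (1 - c ^ 2) ^ m * (1 - (f x) ^ 2) ^ m := by
      rw [div_mul_eq_mul_div, one_mul, le_div_iff₀ hwp, one_mul]; exact hw
    have hK0 : 0 ≤ 1 / (1 - c ^ 2) ^ m := by positivity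
    refine ⟨‖fderiv ℝ f x‖, norm_nonneg _, ?_, fun ε hε ↦ ?_⟩
    · have : ‖fderiv ℝ f x‖ ≤ ‖fderiv ℝ f x‖ ^ p + 1 := by
        rcases le_total ‖fderiv ℝ f x‖ 1 with h | h
        · linarith
        · have := Real.rpow_le_rpow_of_exponent_le h hp.le
          rw [Real.rpow_one] at this; linarith
      nlinarith [mul_nonneg hK0 hD]
    · have hl := hf.hasFDerivAt.isLittleO.def hε
      filter_upwards [hl] with y hy
      refine (abs_trunc_sub_le _ _ _).trans ?_
      have h3 := (fderiv ℝ f x).le_opNorm (y - x)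
      rw [Real.norm_eq_abs] at hy h3
      have := abs_add_le (f y - f x - fderiv ℝ f x (y - x)) (fderiv ℝ f x (y - x))
      rw [sub_add_cancel] at this
      linarith
  · refine ⟨0, le_rfl, ?_, fun ε hε ↦ ?_⟩
    · have hpos : 0 ≤ 1 / (1 - c ^ 2) ^ m :=
        div_nonneg zero_le_one (Real.rpow_nonneg (by nlinarith) _)
      positivity
    · have hcont := hf.continuousAt
      rw [not_and_or, not_le, not_le] at hx
      have : ∀ᶠ y in 𝓝 x, trunc c (f y) = trunc c (f x) := by
        rcases hx with hx | hx
        · filter_upwards [hcont.eventually_lt_const hx] with y hy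
          simp only [trunc]
          rw [max_eq_left ((min_le_left _ _).trans hy.le),
            max_eq_left ((min_le_left _ _).trans hx.le)]
        · filter_upwards [hcont.eventually_const_lt hx] with y hy
          simp only [trunc]
          rw [min_eq_right hy.le, min_eq_right hx.le]
      filter_upwards [this] with y hy
      rw [hy, sub_self, abs_zero]; positivity

lemma norm_gradient_eq {E : Type*} [NormedAddCommGroup E] [InnerProductSpace ℝ E]
    [CompleteSpace E] (f : E → ℝ) (x : E) : ‖gradient f x‖ = ‖fderiv ℝ f x‖ := by
  simp [gradient]

/-- The derivative of the truncated excess of `g` over `v` is controlled by the energy densities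
of `g` and `v`. -/
lemma norm_fderiv_trunc_sub_le {E : Type*} [NormedAddCommGroup E] [NormedSpace ℝ E]
    {p m c : ℝ} (hp : 1 < p) (hpm : p < m) (hc : -1 < c) (hc0 : c < 0) {g v : E → ℝ} {x : E}
    (hg : DifferentiableAt ℝ g x) (hv : DifferentiableAt ℝ v x)
    (hg1 : g x ≤ 1) (hv1 : -1 ≤ v x) (hx : v x < g x) :
    ‖fderiv ℝ (fun y ↦ trunc c (g y) - trunc c (min (g y) (v y))) x‖ ≤
      (1 + 1 / (1 - c ^ 2) ^ m) * ((‖fderiv ℝ g x‖ ^ p + (1 - (g x) ^ 2) ^ m) +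
        (‖fderiv ℝ v x‖ ^ p + (1 - (v x) ^ 2) ^ m)) := by
  obtain ⟨a, ha0, ha, hal⟩ := exists_local_lipschitz_trunc hp hpm hc hc0 hg (by linarith) hg1
  obtain ⟨b, hb0, hb, hbl⟩ := exists_local_lipschitz_trunc hp hpm hc hc0 hv hv1 (by linarith)
  rw [mul_add]
  refine le_trans ?_ (add_le_add ha hb)
  refine le_of_forall_pos_le_add fun ε hε ↦ ?_
  refine norm_fderiv_le_of_lip' ℝ (by positivity) ?_
  filter_upwards [hal (ε / 2) (half_pos hε), hbl (ε / 2) (half_pos hε),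
    hv.continuousAt.eventually_lt hg.continuousAt hx] with y h1 h2 h3
  rw [min_eq_right h3.le, min_eq_right hx.le, Real.norm_eq_abs]
  have := abs_sub (trunc c (g y) - trunc c (g x)) (trunc c (v y) - trunc c (v x))
  calc _ = |(trunc c (g y) - trunc c (g x)) - (trunc c (v y) - trunc c (v x))| := by
        congr 1; ring
    _ ≤ _ := by linarith

lemma fderiv_trunc_sub_eq_zero {E : Type*} [NormedAddCommGroup E] [NormedSpace ℝ E]
    {c : ℝ} {g v : E → ℝ} {x : E} (hx : g x ≤ v x) :
    fderiv ℝ (fun y ↦ trunc c (g y) - trunc c (min (g y) (v y))) x = 0 := by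
  refine IsLocalMin.fderiv_eq_zero (Eventually.of_forall fun y ↦ ?_)
  simp only [min_eq_left hx, sub_self, sub_nonneg]
  exact trunc_mono c (min_le_left _ _)

/-- A Lipschitz function has integrable energy density on a bounded set where its values lie in
`[-1, 1]`. -/
lemma integrableOn_energy {n : ℕ} {p m : ℝ} (hp : 0 ≤ p) (hm : 0 ≤ m)
    {f : EuclideanSpace ℝ (Fin n) → ℝ} {K : ℝ≥0} (hf : LipschitzWith K f)
    {S : Set (EuclideanSpace ℝ (Fin n))} (hS : MeasurableSet S) (hSb : Bornology.IsBounded S)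
    (hf1 : ∀ x ∈ S, -1 ≤ f x ∧ f x ≤ 1) :
    IntegrableOn (fun x ↦ ‖gradient f x‖ ^ p + (1 - (f x) ^ 2) ^ m) S := by
  have hmeas : Measurable (fun x ↦ ‖gradient f x‖ ^ p + (1 - (f x) ^ 2) ^ m) := by
    simp only [norm_gradient_eq]
    exact ((measurable_fderiv ℝ f).norm.pow_const p).add
      (((hf.continuous.measurable.pow_const 2).const_sub 1).pow_const m)
  refine Measure.integrableOn_of_bounded (M := (K : ℝ) ^ p + 1) hSb.measure_lt_top.ne
    hmeas.aestronglyMeasurable ?_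
  refine (ae_restrict_iff' hS).2 (Eventually.of_forall fun x hx ↦ ?_)
  obtain ⟨h1, h2⟩ := hf1 x hx
  have h0 : 0 ≤ 1 - (f x) ^ 2 := by nlinarith
  have h3 : (1 - (f x) ^ 2) ^ m ≤ 1 := Real.rpow_le_one h0 (by nlinarith) hm
  have h4 : ‖gradient f x‖ ^ p ≤ (K : ℝ) ^ p := by
    rw [norm_gradient_eq]
    exact Real.rpow_le_rpow (norm_nonneg _) (norm_fderiv_le_of_lipschitz ℝ hf) hp
  rw [Real.norm_of_nonneg (by have := Real.rpow_nonneg h0 m; positivity)]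
  linarith

/-- A weak-type isoperimetric estimate: the measure of a set on which `g` is nonnegative and `v`
is at most `c < 0` is controlled by the energies of `g` and `v` on `{v < g}`. -/
lemma volume_rpow_le_energy {n : ℕ} (hn : 2 ≤ n) {p m c : ℝ} (hp : 1 < p) (hpm : p < m)
    (hc : -1 < c) (hc0 : c < 0) :
    ∃ C > (0 : ℝ), ∀ (g v : EuclideanSpace ℝ (Fin n) → ℝ) (K L : ℝ≥0),
      LipschitzWith K g → LipschitzWith L v → (∀ x, g x ≤ 1) → (∀ x, -1 ≤ v x) →
      Bornology.IsBounded {x | v x < g x} →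
      (volume {x | 0 ≤ g x ∧ v x ≤ c}).toReal ^ ((n - 1 : ℝ) / n) ≤
        C * (Jpm p m g {x | v x < g x} + Jpm p m v {x | v x < g x}) := by
  have hn1 : (1 : ℝ) < n := by exact_mod_cast hn
  have hn1' : (1 : ℝ≥0) < n := by exact_mod_cast hn
  obtain ⟨q, hq⟩ : ∃ q : ℝ≥0, NNReal.HolderConjugate (n : ℝ≥0) q :=
    ⟨_, NNReal.HolderConjugate.conjExponent hn1'⟩
  have hq0 : 0 < q := hq.symm.pos
  have hqinv : ((n - 1 : ℝ) / n) = 1 / q := by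
    have h := hq.coe.inv_add_inv_eq_one
    push_cast at h
    rw [one_div, sub_div, div_self (by positivity), one_div]
    linarith
  set Cs : ℝ≥0 := eLpNormLESNormFDerivOneConst (volume : Measure (EuclideanSpace ℝ (Fin n))) q
  set M : ℝ := 1 + 1 / (1 - c ^ 2) ^ m with hM
  have hM0 : 0 < M := by
    have : 0 < (1 - c ^ 2) ^ m := Real.rpow_pos_of_pos (by nlinarith) _
    positivity
  have hc_pos : 0 < -c := by linarith
  refine ⟨(-c)⁻¹ * ((Cs + 1) * M), by positivity, ?_⟩
  intro g v K L hg hv hg1 hv1 hSb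
  set S := {x | v x < g x} with hS
  have hSo : IsOpen S := isOpen_lt hv.continuous hg.continuous
  let φ := fun y ↦ trunc c (g y) - trunc c (min (g y) (v y))
  obtain ⟨N, hφL⟩ : ∃ N, LipschitzWith N φ :=
    ⟨_, ((lipschitzWith_trunc c).comp hg).sub ((lipschitzWith_trunc c).comp (hg.min hv))⟩
  have hφ0 : ∀ x ∉ S, φ x = 0 := fun x hx ↦ by
    simp only [hS, mem_ofPred_eq, not_lt] at hx
    simp [φ, min_eq_left hx]
  have hφs : HasCompactSupport φ := by
    refine HasCompactSupport.intro' (K := closure S) hSb.isCompact_closure isClosed_closure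
      fun x hx ↦ hφ0 x fun h ↦ hx (subset_closure h)
  have hgint := integrableOn_energy (p := p) (m := m) (by linarith) (by linarith) hg
    hSo.measurableSet hSb fun x (hx : v x < g x) ↦ ⟨by linarith [hv1 x], hg1 x⟩
  have hvint := integrableOn_energy (p := p) (m := m) (by linarith) (by linarith) hv
    hSo.measurableSet hSb fun x (hx : v x < g x) ↦ ⟨hv1 x, by linarith [hg1 x]⟩
  set J := Jpm p m g S + Jpm p m v S with hJ
  have hnn : ∀ f : EuclideanSpace ℝ (Fin n) → ℝ, ∀ x, -1 ≤ f x → f x ≤ 1 →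
      0 ≤ ‖gradient f x‖ ^ p + (1 - (f x) ^ 2) ^ m := fun f x h1 h2 ↦
    add_nonneg (by positivity) (Real.rpow_nonneg (by nlinarith) _)
  have hJ0 : 0 ≤ J := add_nonneg
    (setIntegral_nonneg hSo.measurableSet fun x (hx : v x < g x) ↦
      hnn g x (by linarith [hv1 x]) (hg1 x))
    (setIntegral_nonneg hSo.measurableSet fun x (hx : v x < g x) ↦
      hnn v x (hv1 x) (by linarith [hg1 x]))
  have hD : eLpNorm (fderiv ℝ φ) 1 volume ≤ ENNReal.ofReal (M * J) := by
    rw [eLpNorm_one_eq_lintegral_enorm]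
    have hset : ∫⁻ x, ‖fderiv ℝ φ x‖ₑ = ∫⁻ x in S, ‖fderiv ℝ φ x‖ₑ := by
      rw [← lintegral_indicator hSo.measurableSet]
      refine lintegral_congr fun x ↦ ?_
      by_cases hx : x ∈ S
      · rw [indicator_of_mem hx]
      · rw [indicator_of_notMem hx]
        rw [hS, mem_ofPred_eq, not_lt] at hx
        rw [← ofReal_norm, fderiv_trunc_sub_eq_zero hx, norm_zero, ENNReal.ofReal_zero]
    have hint : IntegrableOn (fun x ↦ M * ((‖gradient g x‖ ^ p + (1 - (g x) ^ 2) ^ m) +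
        (‖gradient v x‖ ^ p + (1 - (v x) ^ 2) ^ m))) S := (hgint.add hvint).const_mul M
    rw [hset, hJ, Jpm, Jpm, ← integral_add hgint hvint, ← integral_const_mul,
      ofReal_integral_eq_lintegral_ofReal hint]
    · refine lintegral_mono_ae ?_
      filter_upwards [ae_restrict_of_ae hg.ae_differentiableAt,
        ae_restrict_of_ae hv.ae_differentiableAt,
        ae_restrict_mem hSo.measurableSet] with x h1 h2 hx
      rw [← ofReal_norm]
      refine ENNReal.ofReal_le_ofReal ?_
      simp only [norm_gradient_eq]
      exact norm_fderiv_trunc_sub_le hp hpm hc hc0 h1 h2 (hg1 x) (hv1 x) hx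
    · filter_upwards [ae_restrict_mem hSo.measurableSet] with x hx
      have hx' : v x < g x := hx
      exact mul_nonneg hM0.le (add_nonneg (hnn g x (by linarith [hv1 x]) (hg1 x))
        (hnn v x (hv1 x) (by linarith [hg1 x])))
  have hsob := hφL.eLpNorm_le_eLpNorm_fderiv_one volume hφs (q := q) (by
    rwa [finrank_euclideanSpace_fin])
  have hX : eLpNorm φ q volume ≤ ENNReal.ofReal ((Cs + 1) * (M * J)) := by
    refine hsob.trans ?_
    rw [ENNReal.ofReal_mul (by positivity)]
    gcongr
    rw [← ENNReal.ofReal_coe_nnreal]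
    exact ENNReal.ofReal_le_ofReal (by simp [Cs])
  have hcheb := mul_meas_ge_le_pow_eLpNorm' volume (p := (q : ℝ≥0∞)) (by simpa using hq0.ne')
    ENNReal.coe_ne_top hφL.continuous.aestronglyMeasurable (ENNReal.ofReal (-c))
  have hsub : {x | 0 ≤ g x ∧ v x ≤ c} ⊆ {x | ENNReal.ofReal (-c) ≤ ‖φ x‖ₑ} := by
    rintro x ⟨h1, h2⟩
    have : φ x = -c := by
      simp only [φ, trunc]
      rw [min_eq_right h1, max_eq_right hc0.le, min_eq_right (by linarith : v x ≤ g x),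
        max_eq_left ((min_le_left _ _).trans h2), zero_sub]
    simp only [mem_ofPred_eq, this]
    rw [Real.enorm_of_nonneg (by linarith)]
  set V := volume {x | 0 ≤ g x ∧ v x ≤ c}
  have hmain : ENNReal.ofReal (-c) ^ (q : ℝ) * V ≤
      ENNReal.ofReal ((Cs + 1) * (M * J)) ^ (q : ℝ) := by
    refine (mul_le_mul_right (measure_mono hsub) _).trans (hcheb.trans ?_)
    exact ENNReal.rpow_le_rpow hX (by positivity)
  have hV : V ^ (1 / (q : ℝ)) * ENNReal.ofReal (-c) ≤ ENNReal.ofReal ((Cs + 1) * (M * J)) := by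
    have h := ENNReal.rpow_le_rpow hmain (z := 1 / (q : ℝ)) (by positivity)
    rw [ENNReal.mul_rpow_of_nonneg _ _ (by positivity), ← ENNReal.rpow_mul, ← ENNReal.rpow_mul,
      mul_one_div_cancel (by positivity), ENNReal.rpow_one, ENNReal.rpow_one] at h
    rwa [mul_comm]
  have h := ENNReal.toReal_mono ENNReal.ofReal_ne_top hV
  rw [ENNReal.toReal_mul, ← ENNReal.toReal_rpow, ENNReal.toReal_ofReal (by linarith),
    ENNReal.toReal_ofReal (by positivity)] at h
  rw [hqinv, mul_assoc, mul_assoc, inv_mul_eq_div, le_div_iff₀ (by linarith)]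
  exact h

lemma neg_one_le_Uprof {p m : ℝ} (t : ℝ) : -1 ≤ Uprof p m t := by
  unfold Uprof
  split_ifs with h
  · linarith
  · have := Real.rpow_nonneg (by linarith : 0 ≤ 1 - t) (-(p / (m - p)))
    linarith

lemma Uprof_neg_one_mem {p m : ℝ} (hs : 0 < p / (m - p)) :
    -1 < Uprof p m (-1) ∧ Uprof p m (-1) < 0 := by
  rw [Uprof, if_neg (by norm_num)]
  have h1 : 0 < (1 - (-1) : ℝ) ^ (-(p / (m - p))) := Real.rpow_pos_of_pos (by norm_num) _
  have h2 : (1 - (-1) : ℝ) ^ (-(p / (m - p))) < 1 :=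
    Real.rpow_lt_one_of_one_lt_of_neg (by norm_num) (by linarith)
  constructor <;> linarith

lemma Uprof_le_of_le_neg_one {p m t : ℝ} (hs : 0 < p / (m - p)) (ht : t ≤ -1) :
    Uprof p m t ≤ Uprof p m (-1) := by
  rw [Uprof, Uprof, if_neg (by linarith), if_neg (by norm_num)]
  have := Real.rpow_le_rpow_of_nonpos (by norm_num : (0 : ℝ) < 1 - (-1))
    (by linarith : 1 - (-1) ≤ 1 - t) (by linarith : -(p / (m - p)) ≤ 0)
  linarith

lemma lipschitzOnWith_rpow_neg {s : ℝ} (hs : 0 < s) :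
    LipschitzOnWith s.toNNReal (fun t : ℝ ↦ t ^ (-s)) (Ici 1) := by
  refine (convex_Ici 1).lipschitzOnWith_of_nnnorm_hasDerivWithin_le
    (f' := fun t ↦ -s * t ^ (-s - 1)) (fun t ht ↦ ?_) fun t ht ↦ ?_
  · have h0 : (0 : ℝ) < t := zero_lt_one.trans_le ht
    exact (Real.hasDerivAt_rpow_const (Or.inl h0.ne')).hasDerivWithinAt
  · have h1 : (1 : ℝ) ≤ t := ht
    rw [← NNReal.coe_le_coe, coe_nnnorm, Real.coe_toNNReal _ hs.le, norm_mul, norm_neg,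
      Real.norm_of_nonneg hs.le, Real.norm_of_nonneg (by positivity)]
    have := Real.rpow_le_one_of_one_le_of_nonpos h1 (by linarith : -s - 1 ≤ 0)
    nlinarith

lemma exists_lipschitzWith_Uprof {p m : ℝ} (hs : 0 < p / (m - p)) :
    ∃ L : ℝ≥0, LipschitzWith L (Uprof p m) := by
  have h : Uprof p m = fun t ↦ max t 0 + (-1 + (max (1 - t) 1) ^ (-(p / (m - p)))) := by
    funext t
    unfold Uprof
    split_ifs with ht
    · rw [max_eq_left ht, max_eq_right (by linarith), Real.one_rpow]
      ring
    · rw [max_eq_right (by linarith), max_eq_left (by linarith), zero_add]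
  have h1 : LipschitzWith (0 + 1) fun t : ℝ ↦ max (1 - t) 1 :=
    ((LipschitzWith.const 1).sub LipschitzWith.id).max_const 1
  have h2 := (lipschitzOnWith_rpow_neg hs).comp (h1.lipschitzOnWith (s := univ))
    (fun t _ ↦ mem_Ici.2 (le_max_right _ _))
  rw [lipschitzOnWith_univ] at h2
  rw [h]
  exact ⟨_, (LipschitzWith.id.max_const 0).add ((LipschitzWith.const (-1)).add h2)⟩

lemma exists_lipschitzWith_vComp {n : ℕ} {p m : ℝ} (hs : 0 < p / (m - p)) :
    ∃ L : ℝ≥0, ∀ R, LipschitzWith L (vComp (n := n) p m R) := by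
  obtain ⟨L, hL⟩ := exists_lipschitzWith_Uprof hs
  exact ⟨_, fun R ↦ hL.comp (lipschitzWith_one_norm.sub (LipschitzWith.const R))⟩

lemma LocLipOn.locallyLipschitzOn {n : ℕ} {Ω : Set (EuclideanSpace ℝ (Fin n))}
    {u : EuclideanSpace ℝ (Fin n) → ℝ} (hu : LocLipOn Ω u) : LocallyLipschitzOn Ω u := by
  intro x hx
  obtain ⟨K, U, hU, hK⟩ := hu x hx
  exact ⟨K, U, mem_nhdsWithin_of_mem_nhds hU, hK⟩

lemma LocLipOn.min_lipschitzWith {n : ℕ} {Ω : Set (EuclideanSpace ℝ (Fin n))}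
    {u v : EuclideanSpace ℝ (Fin n) → ℝ} (hu : LocLipOn Ω u) {L : ℝ≥0} (hv : LipschitzWith L v) :
    LocLipOn Ω fun x ↦ min (u x) (v x) := by
  intro x hx
  obtain ⟨K, U, hU, hK⟩ := hu x hx
  refine ⟨max K L, U, hU, ?_⟩
  rw [lipschitzOnWith_iff_restrict] at hK ⊢
  exact hK.min (lipschitzOnWith_iff_restrict.1 hv.lipschitzOnWith)

lemma Jpm_congr {n : ℕ} {p m : ℝ} {f g : EuclideanSpace ℝ (Fin n) → ℝ}
    {S : Set (EuclideanSpace ℝ (Fin n))} (hS : IsOpen S) (h : EqOn f g S) :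
    Jpm p m f S = Jpm p m g S := by
  refine setIntegral_congr_fun hS.measurableSet fun x hx ↦ ?_
  have hev : f =ᶠ[𝓝 x] g := h.eventuallyEq_of_mem (hS.mem_nhds hx)
  simp only [norm_gradient_eq, hev.fderiv_eq, h hx]

/-- The key inequality (2.22): `(V_{R-T})^{(n-1)/n} ≤ C J(v_R, S_R)`. -/
theorem volume_bound_by_competitor_energy
    (n : ℕ) (hn : 2 ≤ n) (p m Q : ℝ)
    (hp : 1 < p) (hpm : p < m) (hQ : 1 ≤ Q) :
    ∃ C > (0 : ℝ),
      ∀ Ω : Set (EuclideanSpace ℝ (Fin n)), IsOpen Ω →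
      ∀ u : EuclideanSpace ℝ (Fin n) → ℝ,
        (∀ x, u x ∈ Icc (-1 : ℝ) 1) → LocLipOn Ω u → IsQMinOfJpm p m Q Ω u →
        ∀ R T : ℝ, 1 ≤ T → T ≤ R →
          closure (ball (0 : EuclideanSpace ℝ (Fin n)) (R + 1)) ⊆ Ω →
          (volume ({x | 0 ≤ u x} ∩ ball (0 : EuclideanSpace ℝ (Fin n)) (R - T))).toReal ^
              ((n - 1 : ℝ) / n) ≤
            C * Jpm p m (vComp p m R) (Sset p m R u) := by
  have hmp : 0 < m - p := by linarith
  have hs : 0 < p / (m - p) := div_pos (by linarith) hmp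
  obtain ⟨hc, hc0⟩ := Uprof_neg_one_mem hs
  obtain ⟨L, hL⟩ := exists_lipschitzWith_vComp (n := n) hs
  obtain ⟨C, hC, hmain⟩ := volume_rpow_le_energy hn hp hpm hc hc0
  refine ⟨C * (Q + 1), by positivity, ?_⟩
  intro Ω hΩ u hu1 hu hmin R T hT hTR hsub
  set v := vComp (n := n) p m R with hv
  have hvL : LipschitzWith L v := hL R
  have hv1 : ∀ x, -1 ≤ v x := fun x ↦ neg_one_le_Uprof _
  have hR : R + 1 ≠ 0 := by linarith
  rw [closure_ball _ hR] at hsub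
  obtain ⟨g, K, hg, hg1, hgu⟩ : ∃ (g : EuclideanSpace ℝ (Fin n) → ℝ) (K : ℝ≥0),
      LipschitzWith K g ∧ (∀ x, g x ≤ 1) ∧ EqOn u g (closedBall 0 (R + 1)) := by
    obtain ⟨K, hK⟩ := (hu.locallyLipschitzOn.mono hsub).exists_lipschitzOnWith_of_compact
      (isCompact_closedBall _ _)
    obtain ⟨g, hg, hgu⟩ := hK.extend_real
    refine ⟨fun x ↦ min (g x) 1, K, hg.min_const 1, fun x ↦ min_le_right _ _, fun x hx ↦ ?_⟩
    simp only [← hgu hx, min_eq_left (hu1 x).2]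
  have hv_one : ∀ x, v x < 1 → x ∈ ball (0 : EuclideanSpace ℝ (Fin n)) (R + 1) := fun x hx ↦ by
    rw [mem_ball_zero_iff]
    by_contra! h
    have : v x = ‖x‖ - R := by simp only [hv, vComp, Uprof]; rw [if_pos (by linarith)]
    linarith
  set S := Sset p m R u with hSdef
  have hS : S = {x | v x < g x} := by
    ext x
    constructor
    · rintro ⟨h1, h2⟩
      rwa [mem_ofPred_eq, ← hgu (ball_subset_closedBall h1)]
    · intro (h : v x < g x)
      have hx := hv_one x (h.trans_le (hg1 x))
      exact ⟨hx, by rwa [hgu (ball_subset_closedBall hx)]⟩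
  have hSo : IsOpen S := hS ▸ isOpen_lt hvL.continuous hg.continuous
  have hSball : S ⊆ ball 0 (R + 1) := fun x hx ↦ hx.1
  have hSb : Bornology.IsBounded S := isBounded_ball.subset hSball
  have hJu : Jpm p m u S = Jpm p m g S := Jpm_congr hSo fun x hx ↦
    hgu (ball_subset_closedBall (hSball hx))
  have hJw : Jpm p m (fun x ↦ min (u x) (v x)) S = Jpm p m v S := Jpm_congr hSo fun x hx ↦
    min_eq_right hx.2.le
  have hQm : Jpm p m u S ≤ Q * Jpm p m (fun x ↦ min (u x) (v x)) S := by
    refine hmin S hSo hSb ?_ _ (fun x ↦ ⟨le_min (hu1 x).1 (hv1 x), min_le_of_left_le (hu1 x).2⟩)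
      (hu.min_lipschitzWith hvL) fun x hx ↦ min_eq_left ?_
    · exact (closure_minimal (hSball.trans ball_subset_closedBall) isClosed_closedBall).trans hsub
    · by_contra! h
      exact hx.2 ⟨hv_one x (h.trans_le (hu1 x).2), h⟩
  have hVsub : {x | 0 ≤ u x} ∩ ball (0 : EuclideanSpace ℝ (Fin n)) (R - T) ⊆
      {x | 0 ≤ g x ∧ v x ≤ Uprof p m (-1)} := by
    rintro x ⟨h1, h2⟩
    rw [mem_ball_zero_iff] at h2
    refine ⟨?_, Uprof_le_of_le_neg_one hs (by linarith)⟩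
    rw [← hgu (mem_closedBall_zero_iff.2 (by linarith))]
    exact h1
  have hfin : volume {x | 0 ≤ g x ∧ v x ≤ Uprof p m (-1)} ≠ ⊤ := by
    refine (hSb.subset ?_).measure_lt_top.ne
    rintro x ⟨h1, h2⟩
    rw [hS, mem_ofPred_eq]
    linarith
  have hexp : (0 : ℝ) ≤ (n - 1 : ℝ) / n := by
    have : (1 : ℝ) ≤ n := by exact_mod_cast (by lia : 1 ≤ n)
    exact div_nonneg (by linarith) (by linarith)
  calc _ ≤ (volume {x | 0 ≤ g x ∧ v x ≤ Uprof p m (-1)}).toReal ^ ((n - 1 : ℝ) / n) :=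
        Real.rpow_le_rpow ENNReal.toReal_nonneg
          (ENNReal.toReal_mono hfin (measure_mono hVsub)) hexp
    _ ≤ C * (Jpm p m g S + Jpm p m v S) := by
        rw [hS]; exact hmain g v K L hg hvL hg1 hv1 (hS ▸ hSb)
    _ ≤ C * (Q + 1) * Jpm p m v S := by
        rw [mul_assoc]
        refine mul_le_mul_of_nonneg_left ?_ hC.le
        rw [hJw, hJu] at hQm
        linarith
end
end

section
/- Let u be a Q-minimizer of J on Ω. There exists a constant C = C(n,p,m,Q) > 0 such that for all integers R ≥ T ≥ 1 with the closure of B_{R+2} contained in Ω, J(v_R, S_R) ≤ C ( R^{n−1}·T^{−γ} + M_{R+1} − M_R ). -/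
open MeasureTheory Metric Set

noncomputable section

/-- `V_r = |B_r ∩ {u ≥ 0}|`. -/
def Vvol {n : ℕ} (u : EuclideanSpace ℝ (Fin n) → ℝ) (r : ℝ) : ℝ :=
  (volume (ball (0 : EuclideanSpace ℝ (Fin n)) r ∩ {x | 0 ≤ u x})).toReal

/-- `P_r = ∫_{B_r} W(u) dx` with `W(τ) = (1-τ²)^m`. -/
def Ppot {n : ℕ} (m : ℝ) (u : EuclideanSpace ℝ (Fin n) → ℝ) (r : ℝ) : ℝ :=
  ∫ x in ball (0 : EuclideanSpace ℝ (Fin n)) r, (1 - (u x) ^ 2) ^ m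

/-- The weighted mixture `M_r = Σ_{j=0}^{T} ( P_{r-j} + (1+j)^{-pm/(m-p)} V_{r-j} )`. -/
def Mseq {n : ℕ} (p m : ℝ) (u : EuclideanSpace ℝ (Fin n) → ℝ) (T : ℕ) (r : ℝ) : ℝ :=
  ∑ j ∈ Finset.range (T + 1),
    (Ppot m u (r - j) + ((1 : ℝ) + j) ^ (-(p * m / (m - p))) * Vvol u (r - j))

theorem uprof_eq (p m t : ℝ) :
    Uprof p m t = max t 0 + (-1 + (1 - min t 0) ^ (-(p / (m - p)))) := by
  unfold Uprof
  split_ifs with h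
  · simp [h]
  · push Not at h
    simp [h.le]

theorem neg_one_le_uprof (p m t : ℝ) : -1 ≤ Uprof p m t := by
  unfold Uprof
  split_ifs with h
  · linarith
  · have : 0 ≤ (1 - t) ^ (-(p / (m - p))) := Real.rpow_nonneg (by linarith) _
    linarith

theorem continuous_uprof (p m : ℝ) : Continuous (Uprof p m) := by
  rw [funext (uprof_eq p m)]
  refine (continuous_id.max continuous_const).add (continuous_const.add ?_)
  refine (continuous_const.sub (continuous_id.min continuous_const)).rpow_const fun t => Or.inl ?_
  have : min t 0 ≤ 0 := min_le_right _ _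
  exact (show (0 : ℝ) < 1 - min t 0 by linarith).ne'

theorem continuous_vComp {n : ℕ} (p m R : ℝ) :
    Continuous (vComp p m R : EuclideanSpace ℝ (Fin n) → ℝ) :=
  (continuous_uprof p m).comp (continuous_norm.sub continuous_const)

theorem hasDerivAt_uprof_of_pos (p m : ℝ) {t : ℝ} (ht : 0 < t) : HasDerivAt (Uprof p m) 1 t := by
  refine (hasDerivAt_id t).congr_of_eventuallyEq ?_
  filter_upwards [lt_mem_nhds ht] with s hs
  simp [Uprof, hs.le]

theorem hasDerivAt_uprof_of_neg (p m : ℝ) {t : ℝ} (ht : t < 0) :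
    HasDerivAt (Uprof p m) (p / (m - p) * (1 - t) ^ (-(p / (m - p)) - 1)) t := by
  have h := ((hasDerivAt_id t).const_sub 1).rpow_const (p := -(p / (m - p)))
    (Or.inl (by simp only [id]; linarith))
  refine ((h.const_add (-1)).congr_of_eventuallyEq ?_).congr_deriv (by simp)
  filter_upwards [gt_mem_nhds ht] with s hs
  simp [Uprof, hs]

theorem norm_gradient_vComp_le {n : ℕ} (p m R : ℝ) {x : EuclideanSpace ℝ (Fin n)} (hx : x ≠ 0)
    {d : ℝ} (h : HasDerivAt (Uprof p m) d (‖x‖ - R)) : ‖gradient (vComp p m R) x‖ ≤ |d| := by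
  have hn : DifferentiableAt ℝ (fun y : EuclideanSpace ℝ (Fin n) => ‖y‖) x :=
    (contDiffAt_norm ℝ hx (n := 1)).differentiableAt (by simp)
  have hl : ‖fderiv ℝ (fun y : EuclideanSpace ℝ (Fin n) => ‖y‖) x‖ ≤ 1 := by
    simpa using norm_fderiv_le_of_lipschitz ℝ (x₀ := x) (lipschitzWith_one_norm
      (E := EuclideanSpace ℝ (Fin n)))
  have hc := h.comp_hasFDerivAt x (hn.hasFDerivAt.sub_const R)
  have he : fderiv ℝ (vComp p m R) x = d • fderiv ℝ (fun y => ‖y‖) x := hc.fderiv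
  rw [gradient, LinearIsometryEquiv.norm_map, he, norm_smul, Real.norm_eq_abs]
  exact mul_le_of_le_one_right (abs_nonneg d) hl

theorem vComp_energy_le_of_pos {n : ℕ} {p m R : ℝ} (hp : 0 ≤ p) (hm : 0 ≤ m)
    {x : EuclideanSpace ℝ (Fin n)} (hR : 0 ≤ R) (hx : R < ‖x‖) (hx' : ‖x‖ < R + 1) :
    ‖gradient (vComp p m R) x‖ ^ p + (1 - (vComp p m R x) ^ 2) ^ m ≤ 2 := by
  have h0 : x ≠ 0 := norm_pos_iff.1 (hR.trans_lt hx)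
  have hg := norm_gradient_vComp_le p m R h0 (hasDerivAt_uprof_of_pos p m (sub_pos.2 hx))
  rw [abs_one] at hg
  have hv : vComp p m R x = ‖x‖ - R := by simp [vComp, Uprof, hx.le]
  have h1 := Real.rpow_le_one (norm_nonneg _) hg hp
  have h2 : (1 - (vComp p m R x) ^ 2) ^ m ≤ 1 :=
    Real.rpow_le_one (by rw [hv]; nlinarith) (by nlinarith [sq_nonneg (vComp p m R x)]) hm
  linarith

theorem vComp_energy_le_of_neg {n : ℕ} {p m R : ℝ} (hp : 0 < p) (hpm : p < m)
    {x : EuclideanSpace ℝ (Fin n)} (h0 : x ≠ 0) (hx : ‖x‖ < R) :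
    ‖gradient (vComp p m R) x‖ ^ p + (1 - (vComp p m R x) ^ 2) ^ m ≤
      ((p / (m - p)) ^ p + 2 ^ m) * (1 + R - ‖x‖) ^ (-(p * m / (m - p))) := by
  have hd : 0 < m - p := sub_pos.2 hpm
  have hq : 0 < p / (m - p) := by positivity
  have hg := norm_gradient_vComp_le p m R h0 (hasDerivAt_uprof_of_neg p m (sub_neg.2 hx))
  have ha : 1 - (‖x‖ - R) = 1 + R - ‖x‖ := by ring
  rw [ha] at hg
  have hv : vComp p m R x = -1 + (1 + R - ‖x‖) ^ (-(p / (m - p))) := by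
    simp [vComp, Uprof, hx, ha]
  set a := 1 + R - ‖x‖ with haa
  have ha1 : 1 ≤ a := by linarith
  have hw : 0 < a ^ (-(p / (m - p))) := by positivity
  have hw1 : a ^ (-(p / (m - p))) ≤ 1 := Real.rpow_le_one_of_one_le_of_nonpos ha1 (by linarith)
  rw [abs_of_nonneg (by positivity)] at hg
  have e1 : (p / (m - p) * a ^ (-(p / (m - p)) - 1)) ^ p =
      (p / (m - p)) ^ p * a ^ (-(p * m / (m - p))) := by
    rw [Real.mul_rpow (by positivity) (by positivity), ← Real.rpow_mul (by positivity)]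
    congr 2
    field_simp
    ring
  have e2 : (a ^ (-(p / (m - p)))) ^ m = a ^ (-(p * m / (m - p))) := by
    rw [← Real.rpow_mul (by positivity)]
    congr 1
    field_simp
  have h1 := Real.rpow_le_rpow (norm_nonneg _) hg hp.le
  rw [e1] at h1
  have h2 : (1 - (vComp p m R x) ^ 2) ^ m ≤ 2 ^ m * a ^ (-(p * m / (m - p))) := by
    rw [← e2, ← Real.mul_rpow (by norm_num) hw.le, hv]
    refine Real.rpow_le_rpow ?_ ?_ (by linarith)
    · nlinarith
    · nlinarith
  linarith

theorem rpow_le_potential_of_vComp_lt {n : ℕ} {p m R : ℝ} (hp : 0 < p) (hpm : p < m)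
    {x : EuclideanSpace ℝ (Fin n)} (hx : ‖x‖ < R) {τ : ℝ} (h : vComp p m R x < τ) (hτ : τ < 0) :
    (1 + R - ‖x‖) ^ (-(p * m / (m - p))) ≤ (1 - τ ^ 2) ^ m := by
  have hd : 0 < m - p := sub_pos.2 hpm
  have ha : 1 - (‖x‖ - R) = 1 + R - ‖x‖ := by ring
  have hv : vComp p m R x = -1 + (1 + R - ‖x‖) ^ (-(p / (m - p))) := by
    simp [vComp, Uprof, hx, ha]
  set a := 1 + R - ‖x‖ with haa
  have ha1 : 1 ≤ a := by linarith
  have hw : 0 < a ^ (-(p / (m - p))) := by positivity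
  have e2 : (a ^ (-(p / (m - p)))) ^ m = a ^ (-(p * m / (m - p))) := by
    rw [← Real.rpow_mul (by positivity)]
    congr 1
    field_simp
  rw [← e2]
  rw [hv] at h
  exact Real.rpow_le_rpow hw.le (by nlinarith) (by linarith)

theorem setIntegral_ball_rpow_le {n : ℕ} (hn : n ≠ 0) {s R T : ℝ} (hs : 1 < s) (hT : 0 < T) (hTR : T ≤ R) :
    ∫ x in ball (0 : EuclideanSpace ℝ (Fin n)) (R - T), (1 + R - ‖x‖) ^ (-s) ≤
      n * volume.real (ball (0 : EuclideanSpace ℝ (Fin n)) 1) / (s - 1) *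
        (R ^ (n - 1) * T ^ (-(s - 1))) := by
  have : Nonempty (Fin n) := ⟨⟨0, Nat.pos_of_ne_zero hn⟩⟩
  have hcont : ContinuousOn (fun y : ℝ => (1 + R - y) ^ (-s)) (Icc 0 (R - T)) := by
    refine ContinuousOn.rpow_const (by fun_prop) fun y hy => Or.inl ?_
    have := hy.2
    exact (show 0 < 1 + R - y by linarith).ne'
  have hrad : ∫ y in Ioi (0 : ℝ), y ^ (n - 1) • (Iio (R - T)).indicator
      (fun y : ℝ => (1 + R - y) ^ (-s)) y ≤ R ^ (n - 1) * (T ^ (-(s - 1)) / (s - 1)) := by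
    calc ∫ y in Ioi (0 : ℝ), y ^ (n - 1) • (Iio (R - T)).indicator
          (fun y : ℝ => (1 + R - y) ^ (-s)) y
        = ∫ y in Ioo (0 : ℝ) (R - T), y ^ (n - 1) * (1 + R - y) ^ (-s) := by
          rw [← Ioi_inter_Iio, ← setIntegral_indicator measurableSet_Iio]
          refine integral_congr_ae (Filter.Eventually.of_forall fun y => ?_)
          by_cases hy : y ∈ Iio (R - T) <;> simp [hy]
      _ ≤ ∫ y in Ioo (0 : ℝ) (R - T), R ^ (n - 1) * (1 + R - y) ^ (-s) := by
          have hsub : Ioo (0 : ℝ) (R - T) ⊆ Icc 0 (R - T) := Ioo_subset_Icc_self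
          refine setIntegral_mono_on ?_ ?_ measurableSet_Ioo fun y hy => ?_
          · exact (((continuous_pow _).continuousOn.mul hcont).integrableOn_compact
              isCompact_Icc).mono_set hsub
          · exact ((continuousOn_const.mul hcont).integrableOn_compact isCompact_Icc).mono_set hsub
          · have h1 := hy.1
            have h2 := hy.2
            have h3 : 0 < 1 + R - y := by linarith
            gcongr
            linarith
      _ = R ^ (n - 1) * ∫ y in (0 : ℝ)..(R - T), (1 + R - y) ^ (-s) := by
          rw [integral_const_mul, intervalIntegral.integral_of_le (by linarith),
            integral_Ioc_eq_integral_Ioo]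
      _ ≤ R ^ (n - 1) * (T ^ (-(s - 1)) / (s - 1)) := by
          have hR : 0 ≤ R := hT.le.trans hTR
          gcongr
          rw [intervalIntegral.integral_comp_sub_left (fun z => z ^ (-s)) (1 + R), integral_rpow]
          · have e : -s + 1 = -(s - 1) := by ring
            rw [e, div_neg, ← neg_div, neg_sub, sub_zero, show 1 + R - (R - T) = 1 + T by ring]
            have h1 : 0 ≤ (1 + R) ^ (-(s - 1)) := by positivity
            have h2 : (1 + T) ^ (-(s - 1)) ≤ T ^ (-(s - 1)) :=
              Real.rpow_le_rpow_of_nonpos hT (by linarith) (by linarith)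
            have h3 : 0 ≤ s - 1 := by linarith
            gcongr
            linarith
          · refine Or.inr ⟨by linarith, fun h => ?_⟩
            rw [uIcc_of_le (by linarith)] at h
            linarith [h.1]
  have hpol := integral_fun_norm_addHaar (volume : Measure (EuclideanSpace ℝ (Fin n)))
    ((Iio (R - T)).indicator (fun y : ℝ => (1 + R - y) ^ (-s)))
  rw [finrank_euclideanSpace_fin] at hpol
  calc ∫ x in ball (0 : EuclideanSpace ℝ (Fin n)) (R - T), (1 + R - ‖x‖) ^ (-s)
      = ∫ x : EuclideanSpace ℝ (Fin n),
          (Iio (R - T)).indicator (fun y : ℝ => (1 + R - y) ^ (-s)) ‖x‖ := by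
        rw [← integral_indicator measurableSet_ball]
        congr 1 with x
        by_cases hx : ‖x‖ < R - T <;> simp [hx]
    _ ≤ n * (volume.real (ball (0 : EuclideanSpace ℝ (Fin n)) 1) *
          (R ^ (n - 1) * (T ^ (-(s - 1)) / (s - 1)))) := by
        rw [hpol, nsmul_eq_mul, smul_eq_mul]
        gcongr
    _ = _ := by ring

theorem LocLipOn.continuousOn {n : ℕ} {Ω : Set (EuclideanSpace ℝ (Fin n))}
    {u : EuclideanSpace ℝ (Fin n) → ℝ} (hu : LocLipOn Ω u) : ContinuousOn u Ω := by
  intro x hx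
  obtain ⟨K, U, hU, hK⟩ := hu x hx
  exact (hK.continuousOn.continuousAt hU).continuousWithinAt

section Increment

variable {n : ℕ} {m ρ : ℝ} {u : EuclideanSpace ℝ (Fin n) → ℝ}

theorem potential_mem_Icc (hm : 0 ≤ m) {τ : ℝ} (hτ : τ ∈ Icc (-1 : ℝ) 1) :
    (1 - τ ^ 2) ^ m ∈ Icc (0 : ℝ) 1 := by
  have h : 0 ≤ 1 - τ ^ 2 := by nlinarith [hτ.1, hτ.2]
  exact ⟨Real.rpow_nonneg h m, Real.rpow_le_one h (by nlinarith) hm⟩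

theorem integrableOn_potential (hm : 0 ≤ m) (hu : ∀ x, u x ∈ Icc (-1 : ℝ) 1)
    (hc : ContinuousOn u (ball 0 ρ)) :
    IntegrableOn (fun x => (1 - (u x) ^ 2) ^ m) (ball 0 ρ) := by
  have hW : ContinuousOn (fun x => (1 - (u x) ^ 2) ^ m) (ball 0 ρ) :=
    (continuousOn_const.sub (hc.pow 2)).rpow_const fun _ _ => Or.inr hm
  refine IntegrableOn.of_bound measure_ball_lt_top
    (hW.aestronglyMeasurable measurableSet_ball) 1 (Filter.Eventually.of_forall fun x => ?_)
  have h := potential_mem_Icc hm (hu x)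
  rw [Real.norm_eq_abs, abs_of_nonneg h.1]
  exact h.2

theorem nullMeasurableSet_nonneg (hc : ContinuousOn u (ball 0 ρ)) :
    NullMeasurableSet {x | 0 ≤ u x} (volume.restrict (ball 0 ρ)) :=
  nullMeasurableSet_le aemeasurable_const (hc.aemeasurable measurableSet_ball)

theorem integrableOn_indicator_nonneg (hc : ContinuousOn u (ball 0 ρ)) :
    IntegrableOn ({x | 0 ≤ u x}.indicator fun _ => (1 : ℝ)) (ball 0 ρ) := by
  have h : IntegrableOn (fun _ : EuclideanSpace ℝ (Fin n) => (1 : ℝ)) (ball 0 ρ) :=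
    integrableOn_const measure_ball_lt_top.ne
  exact Integrable.indicator₀ h (nullMeasurableSet_nonneg hc)

theorem Vvol_eq_setIntegral (hc : ContinuousOn u (ball 0 ρ)) :
    Vvol u ρ = ∫ x in ball 0 ρ, {x | 0 ≤ u x}.indicator (fun _ => (1 : ℝ)) x := by
  rw [integral_indicator₀ (nullMeasurableSet_nonneg hc), setIntegral_const, smul_eq_mul, mul_one,
    measureReal_restrict_apply₀ (nullMeasurableSet_nonneg hc), inter_comm]
  rfl

theorem integrableOn_potential_add_mul_indicator (hm : 0 ≤ m) (hu : ∀ x, u x ∈ Icc (-1 : ℝ) 1)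
    (hc : ContinuousOn u (ball 0 ρ)) (c : ℝ) :
    IntegrableOn (fun x => (1 - (u x) ^ 2) ^ m +
      c * {x | 0 ≤ u x}.indicator (fun _ => (1 : ℝ)) x) (ball 0 ρ) :=
  (integrableOn_potential hm hu hc).add ((integrableOn_indicator_nonneg hc).const_mul c)

theorem Ppot_add_mul_Vvol_eq (hm : 0 ≤ m) (hu : ∀ x, u x ∈ Icc (-1 : ℝ) 1)
    (hc : ContinuousOn u (ball 0 ρ)) (c : ℝ) :
    Ppot m u ρ + c * Vvol u ρ = ∫ x in ball 0 ρ,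
      ((1 - (u x) ^ 2) ^ m + c * {x | 0 ≤ u x}.indicator (fun _ => (1 : ℝ)) x) := by
  rw [Vvol_eq_setIntegral hc, Ppot, ← integral_const_mul]
  exact (integral_add (integrableOn_potential hm hu hc)
    ((integrableOn_indicator_nonneg hc).const_mul c)).symm

end Increment

/-- The annular density whose integral is the increment of the `j`-th term of `Mseq`. -/
def shellDensity {n : ℕ} (p m : ℝ) (u : EuclideanSpace ℝ (Fin n) → ℝ) (R : ℝ) (j : ℕ) :
    EuclideanSpace ℝ (Fin n) → ℝ :=
  (ball 0 (R + 1 - j) \ ball 0 (R - j)).indicator fun x =>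
    (1 - (u x) ^ 2) ^ m +
      ((1 : ℝ) + j) ^ (-(p * m / (m - p))) * {x | 0 ≤ u x}.indicator (fun _ => (1 : ℝ)) x

section ShellDensity

variable {n : ℕ} {p m R : ℝ} {u : EuclideanSpace ℝ (Fin n) → ℝ}

theorem shellDensity_nonneg (hm : 0 ≤ m) (hu : ∀ x, u x ∈ Icc (-1 : ℝ) 1) (j : ℕ)
    (x : EuclideanSpace ℝ (Fin n)) : 0 ≤ shellDensity p m u R j x := by
  refine indicator_nonneg (fun y _ => ?_) x
  have h1 := (potential_mem_Icc hm (hu y)).1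
  have h2 : 0 ≤ {x | 0 ≤ u x}.indicator (fun _ => (1 : ℝ)) y :=
    indicator_nonneg (fun _ _ => zero_le_one) y
  positivity

theorem integrable_shellDensity (hm : 0 ≤ m) (hu : ∀ x, u x ∈ Icc (-1 : ℝ) 1)
    (hc : ContinuousOn u (ball 0 (R + 1))) (j : ℕ) : Integrable (shellDensity p m u R j) := by
  refine IntegrableOn.integrable_indicator ?_ (measurableSet_ball.diff measurableSet_ball)
  have h := integrableOn_potential_add_mul_indicator hm hu hc
    (((1 : ℝ) + j) ^ (-(p * m / (m - p))))
  have hj : (0 : ℝ) ≤ j := Nat.cast_nonneg j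
  exact h.mono_set (sdiff_subset.trans (ball_subset_ball (by linarith)))

theorem Mseq_sub_eq_sum_integral (hm : 0 ≤ m) (hu : ∀ x, u x ∈ Icc (-1 : ℝ) 1)
    (hc : ContinuousOn u (ball 0 (R + 1))) (T : ℕ) :
    Mseq p m u T (R + 1) - Mseq p m u T R =
      ∑ j ∈ Finset.range (T + 1), ∫ x, shellDensity p m u R j x := by
  rw [Mseq, Mseq, ← Finset.sum_sub_distrib]
  refine Finset.sum_congr rfl fun j _ => ?_
  have hj : (0 : ℝ) ≤ j := Nat.cast_nonneg j
  have hc1 := hc.mono (ball_subset_ball (show R + 1 - j ≤ R + 1 by linarith))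
  have hc2 := hc.mono (ball_subset_ball (show R - j ≤ R + 1 by linarith))
  have hint := integrableOn_potential_add_mul_indicator hm hu hc1
    (((1 : ℝ) + j) ^ (-(p * m / (m - p))))
  rw [Ppot_add_mul_Vvol_eq hm hu hc1, Ppot_add_mul_Vvol_eq hm hu hc2, shellDensity,
    integral_indicator (measurableSet_ball.diff measurableSet_ball)]
  exact (setIntegral_sdiff measurableSet_ball hint (ball_subset_ball (by linarith))).symm

end ShellDensity

theorem vComp_energy_le_shellDensity {n : ℕ} {p m : ℝ} (hp : 0 < p) (hpm : p < m)
    {u : EuclideanSpace ℝ (Fin n) → ℝ} (hu : ∀ x, u x ∈ Icc (-1 : ℝ) 1) {R : ℝ} {j : ℕ}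
    {x : EuclideanSpace ℝ (Fin n)} (hx : x ∈ Sset p m R u) (hx0 : x ≠ 0) (hxR : ‖x‖ ≠ R)
    (hR : 0 ≤ R) (hj1 : ‖x‖ < R + 1 - j) (hj2 : R - j ≤ ‖x‖) :
    ‖gradient (vComp p m R) x‖ ^ p + (1 - (vComp p m R x) ^ 2) ^ m ≤
      (((p / (m - p)) ^ p + 2 ^ m) * 2 ^ (p * m / (m - p)) + 2) * shellDensity p m u R j x := by
  have hd : 0 < m - p := sub_pos.2 hpm
  have hm : 0 < m := hp.trans hpm
  have hW := (potential_mem_Icc hm.le (hu x)).1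
  set K := (p / (m - p)) ^ p + 2 ^ m with hK
  have hK0 : 0 ≤ K := by positivity
  have hs0 : 0 < p * m / (m - p) := by positivity
  set s := p * m / (m - p) with hs
  have h2s : 1 ≤ (2 : ℝ) ^ s := Real.one_le_rpow (by norm_num) hs0.le
  have hjc : (0 : ℝ) ≤ j := Nat.cast_nonneg j
  have hcj : 0 < ((1 : ℝ) + j) ^ (-s) := by positivity
  have hmem : x ∈ ball (0 : EuclideanSpace ℝ (Fin n)) (R + 1 - j) \ ball 0 (R - j) := by
    simp [hj1, hj2]
  rw [shellDensity, indicator_of_mem hmem]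
  rcases lt_or_gt_of_ne hxR with hlt | hgt
  · have he := vComp_energy_le_of_neg hp hpm hx0 hlt
    refine he.trans ?_
    by_cases h0 : 0 ≤ u x
    · rw [indicator_of_mem (show x ∈ {x | 0 ≤ u x} from h0), mul_one]
      have hle : (1 + R - ‖x‖) ^ (-s) ≤ 2 ^ s * ((1 : ℝ) + j) ^ (-s) := by
        have h1 : (1 + R - ‖x‖) ^ (-s) ≤ ((1 + j) / 2 : ℝ) ^ (-s) := by
          refine Real.rpow_le_rpow_of_nonpos (by positivity) ?_ (by linarith)
          rcases Nat.eq_zero_or_pos j with rfl | hjp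
          · norm_num
            linarith
          · have : (1 : ℝ) ≤ j := by exact_mod_cast hjp
            linarith
        refine h1.trans_eq ?_
        rw [Real.div_rpow (by positivity) (by norm_num), Real.rpow_neg (x := 2) (by norm_num),
          div_inv_eq_mul, mul_comm]
      calc K * (1 + R - ‖x‖) ^ (-s) ≤ K * (2 ^ s * ((1 : ℝ) + j) ^ (-s)) := by gcongr
        _ = (K * 2 ^ s) * ((1 : ℝ) + j) ^ (-s) := by ring
        _ ≤ (K * 2 ^ s + 2) * ((1 - (u x) ^ 2) ^ m + ((1 : ℝ) + j) ^ (-s)) := by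
          gcongr
          · linarith
          · linarith
    · rw [indicator_of_notMem (show x ∉ {x | 0 ≤ u x} from h0), mul_zero, add_zero]
      have hle := rpow_le_potential_of_vComp_lt hp hpm hlt hx.2 (not_le.1 h0)
      have : K ≤ K * 2 ^ s + 2 := by nlinarith
      have ha : 0 ≤ (1 + R - ‖x‖) ^ (-s) := Real.rpow_nonneg (by linarith) _
      gcongr
  · have hball : ‖x‖ < R + 1 := by simpa using hx.1
    have he := vComp_energy_le_of_pos hp.le hm.le hR hgt hball
    have hj0 : j = 0 := by
      have : (j : ℝ) < 1 := by linarith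
      exact Nat.lt_one_iff.1 (by exact_mod_cast this)
    have hu0 : 0 ≤ u x := by
      have hv : vComp p m R x = ‖x‖ - R := by simp [vComp, Uprof, hgt.le]
      have := hx.2
      linarith
    rw [indicator_of_mem (show x ∈ {x | 0 ≤ u x} from hu0), mul_one, hj0]
    simp only [Nat.cast_zero, add_zero, Real.one_rpow]
    have : 0 ≤ K * 2 ^ s := by positivity
    nlinarith

theorem measurableSet_Sset {n : ℕ} {p m R : ℝ} {u : EuclideanSpace ℝ (Fin n) → ℝ}
    (hc : ContinuousOn u (ball 0 (R + 1))) : MeasurableSet (Sset p m R u) := by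
  have h := ((hc.sub (continuous_vComp p m R).continuousOn).isOpen_inter_preimage isOpen_ball
    (isOpen_Ioi (a := (0 : ℝ)))).measurableSet
  convert h using 1
  ext x
  simp [Sset]

theorem vComp_energy_ae_le {n : ℕ} {p m : ℝ} (hn : n ≠ 0) (hp : 0 < p) (hpm : p < m)
    {u : EuclideanSpace ℝ (Fin n) → ℝ} (hu : ∀ x, u x ∈ Icc (-1 : ℝ) 1) {R : ℝ} (hR : 0 ≤ R)
    (hc : ContinuousOn u (ball 0 (R + 1))) (T : ℕ) :
    ∀ᵐ x ∂volume.restrict (Sset p m R u),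
      ‖gradient (vComp p m R) x‖ ^ p + (1 - (vComp p m R x) ^ 2) ^ m ≤
        (((p / (m - p)) ^ p + 2 ^ m) * 2 ^ (p * m / (m - p)) + 2) *
          ((ball 0 (R - T)).indicator (fun x => (1 + R - ‖x‖) ^ (-(p * m / (m - p)))) x +
            ∑ j ∈ Finset.range (T + 1), shellDensity p m u R j x) := by
  have hd : 0 < m - p := sub_pos.2 hpm
  have hm : 0 < m := hp.trans hpm
  have : Nonempty (Fin n) := ⟨⟨0, Nat.pos_of_ne_zero hn⟩⟩
  have hs0 : 0 < p * m / (m - p) := by positivity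
  have hK0 : 0 ≤ (p / (m - p)) ^ p + (2 : ℝ) ^ m := by positivity
  have h2s : 1 ≤ (2 : ℝ) ^ (p * m / (m - p)) := Real.one_le_rpow (by norm_num) hs0.le
  have hnull : ∀ r : ℝ, ∀ᵐ x : EuclideanSpace ℝ (Fin n), ‖x‖ ≠ r := fun r => by
    have h := Measure.addHaar_sphere (volume : Measure (EuclideanSpace ℝ (Fin n))) 0 r
    filter_upwards [measure_eq_zero_iff_ae_notMem.1 h] with x hx
    simpa using hx
  filter_upwards [ae_restrict_mem (measurableSet_Sset hc), ae_restrict_of_ae (hnull 0),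
    ae_restrict_of_ae (hnull R)] with x hx hx0 hxR
  have hx0' : x ≠ 0 := norm_ne_zero_iff.1 hx0
  have hball : ‖x‖ < R + 1 := by simpa using hx.1
  have hsh := fun j => shellDensity_nonneg (p := p) (R := R) hm.le hu j x
  have hTc : (0 : ℝ) ≤ T := Nat.cast_nonneg T
  by_cases hxT : ‖x‖ < R - T
  · have hlt : ‖x‖ < R := by linarith
    rw [indicator_of_mem (by simpa using hxT)]
    refine (vComp_energy_le_of_neg hp hpm hx0' hlt).trans ?_
    have ha : 0 ≤ (1 + R - ‖x‖) ^ (-(p * m / (m - p))) :=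
      Real.rpow_nonneg (by linarith) _
    refine mul_le_mul (by nlinarith) ?_ ha (by positivity)
    exact le_add_of_nonneg_right (Finset.sum_nonneg fun j _ => hsh j)
  · push Not at hxT
    have hj1 : ‖x‖ < R + 1 - (⌈R - ‖x‖⌉₊ : ℝ) := by
      rcases le_or_gt R ‖x‖ with h | h
      · rw [Nat.ceil_eq_zero.2 (by linarith)]
        simpa using hball
      · linarith [Nat.ceil_lt_add_one (show 0 ≤ R - ‖x‖ by linarith)]
    have hj2 : R - (⌈R - ‖x‖⌉₊ : ℝ) ≤ ‖x‖ := by linarith [Nat.le_ceil (R - ‖x‖)]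
    have hj3 : ⌈R - ‖x‖⌉₊ ∈ Finset.range (T + 1) := by
      rw [Finset.mem_range, Nat.lt_succ_iff, Nat.ceil_le]
      linarith
    refine (vComp_energy_le_shellDensity hp hpm hu hx hx0' hxR hR hj1 hj2).trans ?_
    gcongr
    rw [indicator_of_notMem (by simpa using hxT), zero_add]
    exact Finset.single_le_sum (fun j _ => hsh j) hj3

theorem integrableOn_ball_rpow (n : ℕ) {s R T : ℝ} (hT : 0 ≤ T) :
    IntegrableOn (fun x : EuclideanSpace ℝ (Fin n) => (1 + R - ‖x‖) ^ (-s)) (ball 0 (R - T)) := by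
  have hcont : ContinuousOn (fun x : EuclideanSpace ℝ (Fin n) => (1 + R - ‖x‖) ^ (-s))
      (closedBall 0 (R - T)) := by
    refine ContinuousOn.rpow_const (by fun_prop) fun x hx => Or.inl ?_
    have : ‖x‖ ≤ R - T := by simpa using hx
    exact (show 0 < 1 + R - ‖x‖ by linarith).ne'
  exact (hcont.integrableOn_compact (isCompact_closedBall _ _)).mono_set ball_subset_closedBall

theorem Jpm_vComp_le {n : ℕ} {p m : ℝ} (hn : n ≠ 0) (hp : 1 < p) (hpm : p < m)
    {u : EuclideanSpace ℝ (Fin n) → ℝ} (hu : ∀ x, u x ∈ Icc (-1 : ℝ) 1) {R : ℝ} {T : ℕ}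
    (hT : 0 < T) (hTR : T ≤ R) (hc : ContinuousOn u (ball 0 (R + 1))) :
    Jpm p m (vComp p m R) (Sset p m R u) ≤
      (((p / (m - p)) ^ p + 2 ^ m) * 2 ^ (p * m / (m - p)) + 2) *
        (n * volume.real (ball (0 : EuclideanSpace ℝ (Fin n)) 1) / (p * m / (m - p) - 1) *
          (R ^ (n - 1) * (T : ℝ) ^ (-(p * m / (m - p) - 1))) +
          (Mseq p m u T (R + 1) - Mseq p m u T R)) := by
  have hp0 : 0 < p := by linarith
  have hm : 0 < m := by linarith
  have hd : 0 < m - p := sub_pos.2 hpm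
  have hs1 : 1 < p * m / (m - p) := by
    rw [lt_div_iff₀ hd]
    nlinarith
  have hTc : (0 : ℝ) < T := Nat.cast_pos.2 hT
  have hR : 0 ≤ R := hTc.le.trans hTR
  set s := p * m / (m - p) with hs
  have hC : 0 ≤ ((p / (m - p)) ^ p + 2 ^ m) * 2 ^ s + (2 : ℝ) := by positivity
  have hinner : Integrable ((ball (0 : EuclideanSpace ℝ (Fin n)) (R - T)).indicator
      fun x => (1 + R - ‖x‖) ^ (-s)) :=
    (integrableOn_ball_rpow n hTc.le).integrable_indicator measurableSet_ball
  have hshell := fun j => integrable_shellDensity (p := p) hm.le hu hc j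
  have hsum : Integrable fun x => ∑ j ∈ Finset.range (T + 1), shellDensity p m u R j x :=
    integrable_finsetSum _ fun j _ => hshell j
  have hg : Integrable fun x => (((p / (m - p)) ^ p + 2 ^ m) * 2 ^ s + 2) *
      ((ball 0 (R - T)).indicator (fun x => (1 + R - ‖x‖) ^ (-s)) x +
        ∑ j ∈ Finset.range (T + 1), shellDensity p m u R j x) :=
    (hinner.add hsum).const_mul _
  have hle : Jpm p m (vComp p m R) (Sset p m R u) ≤ ∫ x in Sset p m R u,
      (((p / (m - p)) ^ p + 2 ^ m) * 2 ^ s + 2) *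
        ((ball 0 (R - T)).indicator (fun x => (1 + R - ‖x‖) ^ (-s)) x +
          ∑ j ∈ Finset.range (T + 1), shellDensity p m u R j x) := by
    refine integral_mono_of_nonneg ?_ hg.integrableOn (vComp_energy_ae_le hn hp0 hpm hu hR hc T)
    filter_upwards [ae_restrict_mem (measurableSet_Sset hc)] with x hx
    have h1 : -1 ≤ vComp p m R x := neg_one_le_uprof p m _
    have h2 : vComp p m R x ≤ 1 := hx.2.le.trans (hu x).2
    exact add_nonneg (Real.rpow_nonneg (norm_nonneg _) _) (potential_mem_Icc hm.le ⟨h1, h2⟩).1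
  refine hle.trans ((setIntegral_le_integral hg (Filter.Eventually.of_forall fun x => ?_)).trans ?_)
  · refine mul_nonneg hC (add_nonneg (indicator_nonneg (fun y hy => ?_) x)
      (Finset.sum_nonneg fun j _ => shellDensity_nonneg hm.le hu j x))
    have : ‖y‖ < R - T := by simpa using hy
    exact Real.rpow_nonneg (by linarith) _
  · rw [integral_const_mul, integral_add hinner hsum, integral_finsetSum _ fun j _ => hshell j,
      integral_indicator measurableSet_ball, Mseq_sub_eq_sum_integral hm.le hu hc]
    gcongr
    exact setIntegral_ball_rpow_le hn hs1 hTc hTR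

/-- Upper bound for the competitor energy `J(v_R, S_R)` in terms of the increments
of `M` (estimate (2.29)-(2.30) in the paper), with `γ = pm/(m-p) - 1`. -/
theorem competitor_energy_upper_bound
    (n : ℕ) (hn : 2 ≤ n) (p m Q : ℝ)
    (hp : 1 < p) (hpm : p < m) (hQ : 1 ≤ Q) :
    ∃ C > (0 : ℝ),
      ∀ Ω : Set (EuclideanSpace ℝ (Fin n)), IsOpen Ω →
      ∀ u : EuclideanSpace ℝ (Fin n) → ℝ,
        (∀ x, u x ∈ Icc (-1 : ℝ) 1) → LocLipOn Ω u → IsQMinOfJpm p m Q Ω u →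
        ∀ R T : ℕ, 1 ≤ T → T ≤ R →
          closure (ball (0 : EuclideanSpace ℝ (Fin n)) ((R : ℝ) + 2)) ⊆ Ω →
          Jpm p m (vComp p m (R : ℝ)) (Sset p m (R : ℝ) u) ≤
            C * ((R : ℝ) ^ (n - 1) * (T : ℝ) ^ (-(p * m / (m - p) - 1)) +
              (Mseq p m u T ((R : ℝ) + 1) - Mseq p m u T (R : ℝ))) := by
  have hd : 0 < m - p := sub_pos.2 hpm
  have hp0 : 0 < p := by linarith
  have hs1 : 0 < p * m / (m - p) - 1 := by
    rw [sub_pos, lt_div_iff₀ hd]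
    nlinarith
  set c := n * volume.real (ball (0 : EuclideanSpace ℝ (Fin n)) 1) / (p * m / (m - p) - 1) with hc
  set K := ((p / (m - p)) ^ p + 2 ^ m) * 2 ^ (p * m / (m - p)) + (2 : ℝ) with hK
  have hc0 : 0 ≤ c := by positivity
  have hK0 : 0 < K := by positivity
  refine ⟨K * (c + 1), by positivity, ?_⟩
  intro Ω _ u hu hlip _ R T hT hTR hΩ
  have hcont : ContinuousOn u (ball 0 ((R : ℝ) + 1)) :=
    hlip.continuousOn.mono ((ball_subset_ball (by linarith)).trans (subset_closure.trans hΩ))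
  refine (Jpm_vComp_le (by omega) hp hpm hu hT (Nat.cast_le.2 hTR) hcont).trans ?_
  rw [mul_assoc]
  refine mul_le_mul_of_nonneg_left ?_ hK0.le
  have hA : 0 ≤ (R : ℝ) ^ (n - 1) * (T : ℝ) ^ (-(p * m / (m - p) - 1)) := by positivity
  have hM : 0 ≤ Mseq p m u T ((R : ℝ) + 1) - Mseq p m u T (R : ℝ) := by
    rw [Mseq_sub_eq_sum_integral (by linarith) hu hcont]
    exact Finset.sum_nonneg fun j _ =>
      integral_nonneg fun x => shellDensity_nonneg (by linarith) hu j x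
  nlinarith [mul_nonneg hc0 hM]
end
end

section
/- For every sufficiently small h > 0 (depending on p, m, λ, Λ) there exist constants ε > 0 and η ∈ ℝ, real numbers a < 0 < b and s₀ ∈ (−1,0), s₁ ∈ [1−h, 1), and an increasing C¹ function U : [a,b] → [s₀,s₁] such that: U(a) = s₀ < 0, U(b) = s₁ ≥ 1−h, U(0) = 0, U'(a) = U'(b) = 0, W(τ) − ε·τ + η > 0 for all τ ∈ (s₀,s₁), and U satisfies the first-order equation (p−1)·(U'(t))^p = W(U(t)) − ε·U(t) + η for all t ∈ [a,b]; consequently U is C¹ on (a,b) with (U')^{p−1} differentiable and p·d/dt( (U'(t))^{p−1} ) = W'(U(t)) − ε on (a,b). -/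
open Set

noncomputable section

/-- The structural assumptions on the double-well potential `W`
(as in Theorem 3.1 of the paper). -/
def IsAdmissiblePotential (m lam Lam : ℝ) (W : ℝ → ℝ) : Prop :=
  ContDiffOn ℝ 1 W (Ioo (-1 : ℝ) 1) ∧
  (∀ τ ∈ Ioo (-1 : ℝ) 1, 0 < W τ) ∧
  (∀ τ ∈ Ioo (-1 : ℝ) 1,
    lam ≤ W τ / (1 - τ ^ 2) ^ m ∧ W τ / (1 - τ ^ 2) ^ m ≤ Lam) ∧
  (∀ τ : ℝ, 1 / 2 < |τ| → |τ| < 1 →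
    lam ≤ -(deriv W τ) * Real.sign τ / (1 - τ ^ 2) ^ (m - 1) ∧
    -(deriv W τ) * Real.sign τ / (1 - τ ^ 2) ^ (m - 1) ≤ Lam) ∧
  W (-1) = 0 ∧ W 1 = 0

/-- A function vanishing at the left end with positive slope and positive afterwards
dominates a linear function. -/
lemma exists_linear_lower_bound {G : ℝ → ℝ} {α β d : ℝ} (hαβ : α < β)
    (hG : ContinuousOn G (Icc α β)) (hd : HasDerivAt G d α) (hd0 : 0 < d) (h0 : G α = 0)
    (hpos : ∀ s ∈ Ioc α β, 0 < G s) :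
    ∃ c > 0, ∀ s ∈ Icc α β, c * (s - α) ≤ G s := by
  have hc : ContinuousOn (dslope G α) (Icc α β) := by
    intro x hx
    rcases eq_or_ne x α with rfl | hne
    · exact (continuousAt_dslope_same.2 hd.differentiableAt).continuousWithinAt
    · exact (continuousWithinAt_dslope_of_ne hne).2 (hG x hx)
  obtain ⟨x, hx, hmin⟩ := isCompact_Icc.exists_isMinOn (nonempty_Icc.2 hαβ.le) hc
  refine ⟨dslope G α x, ?_, fun s hs => ?_⟩
  · rcases eq_or_ne x α with rfl | hne
    · simpa [dslope_same, hd.deriv] using hd0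
    · have hlt : α < x := lt_of_le_of_ne hx.1 hne.symm
      rw [dslope_of_ne _ hne, slope_def_field, h0, sub_zero]
      exact div_pos (hpos x ⟨hlt, hx.2⟩) (sub_pos.2 hlt)
  · have h1 : dslope G α x ≤ dslope G α s := hmin hs
    have h2 := sub_smul_dslope G α s
    rw [h0, sub_zero, smul_eq_mul] at h2
    nlinarith [mul_le_mul_of_nonneg_right h1 (sub_nonneg.2 hs.1)]

lemma intervalIntegrable_rpow_neg_of_pos_slope {G : ℝ → ℝ} {α β d r : ℝ} (hαβ : α < β)
    (hr0 : 0 < r) (hr1 : r < 1)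
    (hG : ContinuousOn G (Icc α β)) (hd : HasDerivAt G d α) (hd0 : 0 < d) (h0 : G α = 0)
    (hpos : ∀ s ∈ Ioc α β, 0 < G s) :
    IntervalIntegrable (fun s => (G s) ^ (-r)) MeasureTheory.volume α β := by
  obtain ⟨c, hc, hlow⟩ := exists_linear_lower_bound hαβ hG hd hd0 h0 hpos
  have hI : IntervalIntegrable (fun s => c ^ (-r) * (s - α) ^ (-r)) MeasureTheory.volume α β := by
    have h1 : IntervalIntegrable (fun s : ℝ => s ^ (-r)) MeasureTheory.volume (α - α) (β - α) :=
      intervalIntegral.intervalIntegrable_rpow' (by linarith)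
    have h2 := (h1.comp_sub_right α).const_mul (c ^ (-r))
    simpa using h2
  refine hI.mono_fun ?_ ?_
  · rw [uIoc_of_le hαβ.le]
    refine ContinuousOn.aestronglyMeasurable ?_ measurableSet_Ioc
    exact (hG.mono Ioc_subset_Icc_self).rpow_const fun s hs => Or.inl (hpos s hs).ne'
  · rw [uIoc_of_le hαβ.le]
    refine (MeasureTheory.ae_restrict_iff' measurableSet_Ioc).2 (Filter.Eventually.of_forall fun s hs => ?_)
    have hs0 : 0 < s - α := sub_pos.2 hs.1
    beta_reduce
    rw [Real.norm_of_nonneg (Real.rpow_nonneg (hpos s hs).le _),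
      Real.norm_of_nonneg (by positivity), ← Real.mul_rpow hc.le hs0.le]
    exact Real.rpow_le_rpow_of_nonpos (by positivity) (hlow s (Ioc_subset_Icc_self hs))
      (by linarith)

lemma intervalIntegrable_rpow_neg_of_neg_slope {G : ℝ → ℝ} {α β d r : ℝ} (hαβ : α < β)
    (hr0 : 0 < r) (hr1 : r < 1)
    (hG : ContinuousOn G (Icc α β)) (hd : HasDerivAt G d β) (hd0 : d < 0) (h0 : G β = 0)
    (hpos : ∀ s ∈ Ico α β, 0 < G s) :
    IntervalIntegrable (fun s => (G s) ^ (-r)) MeasureTheory.volume α β := by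
  have h := intervalIntegrable_rpow_neg_of_pos_slope (G := fun s => G (-s)) (α := -β) (β := -α)
    (d := -d) (r := r) (by linarith) hr0 hr1
    (hG.comp continuousOn_neg fun s hs => ⟨by linarith [hs.2], by linarith [hs.1]⟩)
    (by
      have h1 : HasDerivAt G d (-(-β)) := by simpa using hd
      simpa [Function.comp_def] using h1.comp (-β) (hasDerivAt_neg (-β)))
    (by linarith) (by simpa using h0)
    (fun s hs => hpos _ ⟨by linarith [hs.2], by linarith [hs.1]⟩)
  have h2 := (IntervalIntegrable.iff_comp_neg).1 h
  simpa using h2.symm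

/-- Separation of variables for `U' = f (U)`, `U 0 = 0`, when `1 / f` is integrable up to the
endpoints of the interval where `f` is positive. -/
lemma exists_solution_of_integrable_inv {f : ℝ → ℝ} {α β : ℝ} (hα : α < 0) (hβ : 0 < β)
    (hf : ContinuousOn f (Icc α β)) (hpos : ∀ s ∈ Ioo α β, 0 < f s)
    (hI : IntervalIntegrable (fun s => (f s)⁻¹) MeasureTheory.volume α β) :
    ∃ a b : ℝ, ∃ U : ℝ → ℝ, a < 0 ∧ 0 < b ∧ (∀ t ∈ Icc a b, U t ∈ Icc α β) ∧
      StrictMonoOn U (Icc a b) ∧ U a = α ∧ U b = β ∧ U 0 = 0 ∧ ContinuousOn U (Icc a b) ∧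
      ∀ t ∈ Icc a b, HasDerivWithinAt U (f (U t)) (Icc a b) t := by
  have hαβ : α < β := hα.trans hβ
  have hαm : α ∈ Icc α β := left_mem_Icc.2 hαβ.le
  have hβm : β ∈ Icc α β := right_mem_Icc.2 hαβ.le
  have h0m : (0 : ℝ) ∈ Icc α β := ⟨hα.le, hβ.le⟩
  have hsub : ∀ x ∈ Icc α β, ∀ y ∈ Icc α β,
      IntervalIntegrable (fun s => (f s)⁻¹) MeasureTheory.volume x y := fun x hx y hy =>
    hI.mono_set (by rw [uIcc_of_le hαβ.le]; exact uIcc_subset_Icc hx hy)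
  set T : ℝ → ℝ := fun u => ∫ s in (0 : ℝ)..u, (f s)⁻¹ with hT
  have hT0 : T 0 = 0 := by simp [hT]
  have hTmono : StrictMonoOn T (Icc α β) := by
    intro x hx y hy hxy
    have h1 : T y - T x = ∫ s in x..y, (f s)⁻¹ :=
      intervalIntegral.integral_interval_sub_left (hsub _ h0m _ hy) (hsub _ h0m _ hx)
    have h2 : 0 < ∫ s in x..y, (f s)⁻¹ :=
      intervalIntegral.intervalIntegral_pos_of_pos_on (hsub _ hx _ hy)
        (fun s hs => inv_pos.2 (hpos s ⟨hx.1.trans_lt hs.1, hs.2.trans_le hy.2⟩)) hxy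
    linarith
  have hTcont : ContinuousOn T (Icc α β) := by
    have := intervalIntegral.continuousOn_primitive_interval' (a := 0) hI
      (by rw [uIcc_of_le hαβ.le]; exact h0m)
    rwa [uIcc_of_le hαβ.le] at this
  have hTderiv : ∀ u ∈ Ioo α β, HasDerivAt T (f u)⁻¹ u := by
    intro u hu
    have hc : ContinuousOn (fun s => (f s)⁻¹) (Ioo α β) :=
      (hf.mono Ioo_subset_Icc_self).inv₀ fun s hs => (hpos s hs).ne'
    exact intervalIntegral.integral_hasDerivAt_right (hsub _ h0m _ (Ioo_subset_Icc_self hu))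
      (hc.stronglyMeasurableAtFilter isOpen_Ioo u hu) (hc.continuousAt (isOpen_Ioo.mem_nhds hu))
  set a := T α with ha
  set b := T β with hb
  have ha0 : a < 0 := by simpa [hT0] using hTmono hαm h0m hα
  have hb0 : 0 < b := by simpa [hT0] using hTmono h0m hβm hβ
  have hab : a < b := ha0.trans hb0
  have hmaps : ∀ u ∈ Icc α β, T u ∈ Icc a b := fun u hu =>
    ⟨hTmono.monotoneOn hαm hu hu.1, hTmono.monotoneOn hu hβm hu.2⟩
  have hsurj : SurjOn T (Icc α β) (Icc a b) := intermediate_value_Icc hαβ.le hTcont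
  set U : ℝ → ℝ := Function.invFunOn T (Icc α β) with hU
  have hUm : ∀ t ∈ Icc a b, U t ∈ Icc α β := fun t ht => Function.invFunOn_mem (hsurj ht)
  have hTU : ∀ t ∈ Icc a b, T (U t) = t := fun t ht => Function.invFunOn_eq (hsurj ht)
  have hUT : ∀ u ∈ Icc α β, U (T u) = u := fun u hu =>
    hTmono.injOn (hUm _ (hmaps u hu)) hu (hTU _ (hmaps u hu))
  have hUmono : StrictMonoOn U (Icc a b) := by
    intro x hx y hy hxy
    rw [← hTU x hx, ← hTU y hy] at hxy
    exact (hTmono.lt_iff_lt (hUm x hx) (hUm y hy)).1 hxy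
  have hUa : U a = α := hUT α hαm
  have hUb : U b = β := hUT β hβm
  have hU0 : U 0 = 0 := by simpa [hT0] using hUT 0 h0m
  have hUcont : ContinuousOn U (Icc a b) := by
    let g : Icc a b → Icc α β := fun t => ⟨U t, hUm t t.2⟩
    have hg : Monotone g := fun x y hxy => hUmono.monotoneOn x.2 y.2 hxy
    have hgs : Function.Surjective g := fun u =>
      ⟨⟨T u, hmaps u u.2⟩, Subtype.ext (hUT u u.2)⟩
    rw [continuousOn_iff_continuous_domRestrict]
    exact continuous_subtype_val.comp (hg.continuous_of_surjective hgs)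
  have ham : a ∈ Icc a b := left_mem_Icc.2 hab.le
  have hbm : b ∈ Icc a b := right_mem_Icc.2 hab.le
  have hUint : ∀ t ∈ Ioo a b, U t ∈ Ioo α β := fun t ht =>
    ⟨hUa ▸ hUmono ham (Ioo_subset_Icc_self ht) ht.1,
      hUb ▸ hUmono (Ioo_subset_Icc_self ht) hbm ht.2⟩
  have hUderiv : ∀ t ∈ Ioo a b, HasDerivAt U (f (U t)) t := by
    intro t ht
    have h1 := HasDerivAt.of_local_left_inverse (hUcont.continuousAt (Icc_mem_nhds ht.1 ht.2))
      (hTderiv _ (hUint t ht)) (inv_ne_zero (hpos _ (hUint t ht)).ne')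
      (Filter.eventually_of_mem (Icc_mem_nhds ht.1 ht.2) hTU)
    simpa using h1
  have hfU : ContinuousOn (fun t => f (U t)) (Icc a b) := hf.comp hUcont hUm
  have hdiff : DifferentiableOn ℝ U (Ioo a b) := fun t ht =>
    (hUderiv t ht).differentiableAt.differentiableWithinAt
  refine ⟨a, b, U, ha0, hb0, hUm, hUmono, hUa, hUb, hU0, hUcont, fun t ht => ?_⟩
  rcases eq_or_lt_of_le ht.1 with rfl | hat
  · refine (hasDerivWithinAt_Ici_of_tendsto_deriv (s := Ioo a b) hdiff
      ((hUcont a ham).mono Ioo_subset_Icc_self) (Ioo_mem_nhdsGT hab) ?_).mono Icc_subset_Ici_self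
    have h1 : Filter.Tendsto (fun t => f (U t)) (nhdsWithin a (Ioi a)) (nhds (f (U a))) := by
      rw [← nhdsWithin_Ioo_eq_nhdsGT hab]
      exact (hfU a ham).mono Ioo_subset_Icc_self
    exact h1.congr' (Filter.eventually_of_mem (Ioo_mem_nhdsGT hab)
      fun t ht => (hUderiv t ht).deriv.symm)
  · rcases eq_or_lt_of_le ht.2 with rfl | htb
    · refine (hasDerivWithinAt_Iic_of_tendsto_deriv (s := Ioo a b) hdiff
        ((hUcont b hbm).mono Ioo_subset_Icc_self) (Ioo_mem_nhdsLT hab) ?_).mono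
        Icc_subset_Iic_self
      have h1 : Filter.Tendsto (fun t => f (U t)) (nhdsWithin b (Iio b)) (nhds (f (U b))) := by
        rw [← nhdsWithin_Ioo_eq_nhdsLT hab]
        exact (hfU b hbm).mono Ioo_subset_Icc_self
      exact h1.congr' (Filter.eventually_of_mem (Ioo_mem_nhdsLT hab)
        fun t ht => (hUderiv t ht).deriv.symm)
    · exact (hUderiv t ⟨hat, htb⟩).hasDerivWithinAt

/-- First-order equation `(p - 1) (U')^p = G (U)` between two simple zeros of `G`. -/
lemma exists_profile_between_simple_zeros {G G' : ℝ → ℝ} {p α β : ℝ} (hp : 1 < p)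
    (hα : α < 0) (hβ : 0 < β) (hG : ∀ s ∈ Icc α β, HasDerivAt G (G' s) s)
    (hpos : ∀ s ∈ Ioo α β, 0 < G s) (hGα : G α = 0) (hGβ : G β = 0)
    (hdα : 0 < G' α) (hdβ : G' β < 0) :
    ∃ a b : ℝ, ∃ U U' : ℝ → ℝ, a < 0 ∧ 0 < b ∧
      (∀ t ∈ Icc a b, U t ∈ Icc α β) ∧
      StrictMonoOn U (Icc a b) ∧
      (∀ t ∈ Icc a b, HasDerivWithinAt U (U' t) (Icc a b) t) ∧
      ContinuousOn U' (Icc a b) ∧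
      (∀ t ∈ Icc a b, 0 ≤ U' t) ∧
      U a = α ∧ U b = β ∧ U 0 = 0 ∧ U' a = 0 ∧ U' b = 0 ∧
      (∀ t ∈ Icc a b, (p - 1) * (U' t) ^ p = G (U t)) ∧
      (∀ t ∈ Ioo a b, HasDerivAt (fun s => (U' s) ^ (p - 1)) (G' (U t) / p) t) := by
  have hp0 : 0 < p := by linarith
  have hp1 : 0 < p - 1 := by linarith
  have hr0 : 0 < 1 / p := by positivity
  have hr1 : 1 / p < 1 := by rw [div_lt_one hp0]; exact hp
  have hαβ : α < β := hα.trans hβ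
  have hGc : ContinuousOn G (Icc α β) := fun s hs => (hG s hs).continuousAt.continuousWithinAt
  have hG0 : ∀ s ∈ Icc α β, 0 ≤ G s := by
    intro s hs
    rcases eq_or_lt_of_le hs.1 with rfl | h1
    · exact hGα.ge
    · rcases eq_or_lt_of_le hs.2 with rfl | h2
      · exact hGβ.ge
      · exact (hpos s ⟨h1, h2⟩).le
  set g : ℝ → ℝ := fun s => G s / (p - 1) with hg
  have hgc : ContinuousOn g (Icc α β) := hGc.div_const _
  have hgd : ∀ s ∈ Icc α β, HasDerivAt g (G' s / (p - 1)) s := fun s hs =>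
    (hG s hs).div_const _
  have hgpos : ∀ s ∈ Ioo α β, 0 < g s := fun s hs => div_pos (hpos s hs) hp1
  have hg0 : ∀ s ∈ Icc α β, 0 ≤ g s := fun s hs => div_nonneg (hG0 s hs) hp1.le
  have hfc : ContinuousOn (fun s => g s ^ (1 / p)) (Icc α β) :=
    hgc.rpow_const fun s _ => Or.inr hr0.le
  have hI1 : IntervalIntegrable (fun s => (g s) ^ (-(1 / p))) MeasureTheory.volume α 0 :=
    intervalIntegrable_rpow_neg_of_pos_slope hα hr0 hr1
      (hgc.mono (Icc_subset_Icc_right hβ.le)) (hgd α (left_mem_Icc.2 hαβ.le))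
      (div_pos hdα hp1) (by simp [hg, hGα])
      fun s hs => hgpos s ⟨hs.1, hs.2.trans_lt hβ⟩
  have hI2 : IntervalIntegrable (fun s => (g s) ^ (-(1 / p))) MeasureTheory.volume 0 β :=
    intervalIntegrable_rpow_neg_of_neg_slope hβ hr0 hr1
      (hgc.mono (Icc_subset_Icc_left hα.le)) (hgd β (right_mem_Icc.2 hαβ.le))
      (div_neg_of_neg_of_pos hdβ hp1) (by simp [hg, hGβ])
      fun s hs => hgpos s ⟨hα.trans_le hs.1, hs.2⟩
  have hI : IntervalIntegrable (fun s => (g s ^ (1 / p))⁻¹) MeasureTheory.volume α β := by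
    refine (hI1.trans hI2).congr ?_
    intro s hs
    rw [uIoc_of_le hαβ.le] at hs
    exact Real.rpow_neg (hg0 s (Ioc_subset_Icc_self hs)) _
  obtain ⟨a, b, U, ha, hb, hUm, hmono, hUa, hUb, hU0, hUc, hder⟩ :=
    exists_solution_of_integrable_inv hα hβ hfc
      (fun s hs => Real.rpow_pos_of_pos (hgpos s hs) _) hI
  have hab : a < b := ha.trans hb
  have hUint : ∀ t ∈ Ioo a b, U t ∈ Ioo α β := fun t ht =>
    ⟨hUa ▸ hmono (left_mem_Icc.2 hab.le) (Ioo_subset_Icc_self ht) ht.1,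
      hUb ▸ hmono (Ioo_subset_Icc_self ht) (right_mem_Icc.2 hab.le) ht.2⟩
  refine ⟨a, b, U, fun t => g (U t) ^ (1 / p), ha, hb, hUm, hmono, hder, hfc.comp hUc hUm,
    fun t ht => Real.rpow_nonneg (hg0 _ (hUm t ht)) _, hUa, hUb, hU0, ?_, ?_,
    fun t ht => ?_, fun t ht => ?_⟩
  · simp [hUa, hg, hGα, hp0.ne']
  · simp [hUb, hg, hGβ, hp0.ne']
  · rw [← Real.rpow_mul (hg0 _ (hUm t ht)), one_div_mul_cancel hp0.ne', Real.rpow_one]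
    exact mul_div_cancel₀ _ hp1.ne'
  · have hgt := hgpos _ (hUint t ht)
    have hnhds := Icc_mem_nhds ht.1 ht.2
    have hUd : HasDerivAt U (g (U t) ^ (1 / p)) t :=
      (hder t (Ioo_subset_Icc_self ht)).hasDerivAt hnhds
    have h1 := ((hgd _ (hUm t (Ioo_subset_Icc_self ht))).comp t hUd).rpow_const
      (p := (p - 1) / p) (Or.inl hgt.ne')
    have hexp : g (U t) ^ (1 / p) * g (U t) ^ ((p - 1) / p - 1) = 1 := by
      rw [← Real.rpow_add hgt]
      have : 1 / p + ((p - 1) / p - 1) = 0 := by field_simp; ring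
      rw [this, Real.rpow_zero]
    have h2 : HasDerivAt (fun s => (g (U s)) ^ ((p - 1) / p)) (G' (U t) / p) t := by
      refine h1.congr_deriv ?_
      calc G' (U t) / (p - 1) * g (U t) ^ (1 / p) * ((p - 1) / p)
            * g (U t) ^ ((p - 1) / p - 1)
          = G' (U t) / (p - 1) * ((p - 1) / p)
            * (g (U t) ^ (1 / p) * g (U t) ^ ((p - 1) / p - 1)) := by ring
        _ = G' (U t) / p := by rw [hexp]; field_simp
    refine h2.congr_of_eventuallyEq (Filter.eventually_of_mem hnhds fun s hs => ?_)
    simp only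
    rw [← Real.rpow_mul (hg0 _ (hUm s hs))]
    congr 1
    ring

/-- Construction of the one-dimensional supersolution profile solving
`p ((U')^{p-1})' = W'(U) - ε` (equation (3.4) in the paper). -/
theorem supersolution_profile_construction
    (p m lam Lam : ℝ) (hp : 1 < p) (hpm : p < m) (hlam : 0 < lam) (hlL : lam ≤ Lam) :
    ∃ h₀ > (0 : ℝ),
      ∀ h : ℝ, 0 < h → h ≤ h₀ →
      ∀ W : ℝ → ℝ, IsAdmissiblePotential m lam Lam W →
        ∃ ε > (0 : ℝ), ∃ η : ℝ, ∃ a b s₀ s₁ : ℝ, ∃ U U' : ℝ → ℝ,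
          a < 0 ∧ 0 < b ∧
          s₀ ∈ Ioo (-1 : ℝ) 0 ∧ s₁ ∈ Ico (1 - h) 1 ∧
          (∀ t ∈ Icc a b, U t ∈ Icc s₀ s₁) ∧
          StrictMonoOn U (Icc a b) ∧
          (∀ t ∈ Icc a b, HasDerivWithinAt U (U' t) (Icc a b) t) ∧
          ContinuousOn U' (Icc a b) ∧
          (∀ t ∈ Icc a b, 0 ≤ U' t) ∧
          U a = s₀ ∧ U b = s₁ ∧ U 0 = 0 ∧ U' a = 0 ∧ U' b = 0 ∧
          (∀ τ ∈ Ioo s₀ s₁, 0 < W τ - ε * τ + η) ∧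
          (∀ t ∈ Icc a b, (p - 1) * (U' t) ^ p = W (U t) - ε * U t + η) ∧
          (∀ t ∈ Ioo a b,
            HasDerivAt (fun s => (U' s) ^ (p - 1)) ((deriv W (U t) - ε) / p) t) := by
  have hLam : 0 < Lam := hlam.trans_le hlL
  have hm1 : 1 < m := hp.trans hpm
  have hm0 : 0 < m := by linarith
  have hq0 : 0 < lam / Lam := by positivity
  have hq1 : lam / Lam ≤ 1 := (div_le_one hLam).2 hlL
  set K : ℝ := 3 / 4 * (lam / Lam) with hK
  have hK0 : 0 < K := by positivity
  refine ⟨K * (lam / Lam / 2) / 2, by positivity, ?_⟩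
  intro h hh hh₀ W hW
  obtain ⟨hWc, -, hWb, hWd, -, -⟩ := hW
  have hK34 : K ≤ 3 / 4 := by rw [hK]; linarith
  have hh4 : h ≤ 1 / 4 := by nlinarith
  have hsmall : Lam * (2 * h) ^ m < lam * K ^ m := by
    have h1 : (2 * h) ^ m ≤ (K * (lam / Lam / 2)) ^ m :=
      Real.rpow_le_rpow (by positivity) (by linarith) hm0.le
    rw [Real.mul_rpow hK0.le (by positivity)] at h1
    have h2 : (lam / Lam / 2) ^ m ≤ lam / Lam / 2 := by
      simpa using Real.rpow_le_rpow_of_exponent_ge (by positivity : 0 < lam / Lam / 2)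
        (by linarith) hm1.le
    have hKm : 0 < K ^ m := Real.rpow_pos_of_pos hK0 m
    calc Lam * (2 * h) ^ m ≤ Lam * (K ^ m * (lam / Lam / 2)) := by
          gcongr
          exact h1.trans (by gcongr)
      _ = lam * K ^ m / 2 := by field_simp
      _ < lam * K ^ m := by linarith [mul_pos hlam hKm]
  have hsq : ∀ τ ∈ Ioo (-1 : ℝ) 1, 0 < 1 - τ ^ 2 := fun τ hτ => by nlinarith [hτ.1, hτ.2]
  have hWlow : ∀ τ ∈ Ioo (-1 : ℝ) 1, lam * (1 - τ ^ 2) ^ m ≤ W τ := fun τ hτ =>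
    (le_div_iff₀ (Real.rpow_pos_of_pos (hsq τ hτ) m)).1 (hWb τ hτ).1
  have hWup : ∀ τ ∈ Ioo (-1 : ℝ) 1, W τ ≤ Lam * (1 - τ ^ 2) ^ m := fun τ hτ =>
    (div_le_iff₀ (Real.rpow_pos_of_pos (hsq τ hτ) m)).1 (hWb τ hτ).2
  have hWder : ∀ τ ∈ Ioo (-1 : ℝ) 1, HasDerivAt W (deriv W τ) τ := fun τ hτ =>
    ((hWc.differentiableOn one_ne_zero).differentiableAt
      (isOpen_Ioo.mem_nhds hτ)).hasDerivAt
  have hWneg : ∀ τ ∈ Ioo (1 / 2 : ℝ) 1, deriv W τ < 0 := by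
    intro τ hτ
    have hτ0 : 0 < τ := by linarith [hτ.1]
    have h1 := (hWd τ (by rw [abs_of_pos hτ0]; exact hτ.1) (by rw [abs_of_pos hτ0]; exact hτ.2)).1
    have hs := Real.rpow_pos_of_pos (hsq τ ⟨by linarith, hτ.2⟩) (m - 1)
    rw [Real.sign_of_pos hτ0, le_div_iff₀ hs] at h1
    linarith [mul_pos hlam hs]
  have hWpos : ∀ τ ∈ Ioo (-1 : ℝ) (-1 / 2), lam * (1 - τ ^ 2) ^ (m - 1) ≤ deriv W τ := by
    intro τ hτ
    have hτ0 : τ < 0 := by linarith [hτ.2]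
    have h1 := (hWd τ (by rw [abs_of_neg hτ0]; linarith [hτ.2])
      (by rw [abs_of_neg hτ0]; linarith [hτ.1])).1
    have hs := Real.rpow_pos_of_pos (hsq τ ⟨hτ.1, by linarith⟩) (m - 1)
    rw [Real.sign_of_neg hτ0, le_div_iff₀ hs] at h1
    linarith
  have hs₁ : 1 - h ∈ Ioo (-1 : ℝ) 1 := ⟨by linarith, by linarith⟩
  set s₁ : ℝ := 1 - h with hs₁def
  set w : ℝ := W s₁ with hw
  have hw0 : 0 < w := (mul_pos hlam (Real.rpow_pos_of_pos (hsq _ hs₁) m)).trans_le (hWlow _ hs₁)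
  have hwK : w < lam * K ^ m := by
    refine lt_of_le_of_lt ((hWup _ hs₁).trans ?_) hsmall
    have : 1 - s₁ ^ 2 ≤ 2 * h := by rw [hs₁def]; nlinarith
    have h0 := (hsq _ hs₁).le
    gcongr
  set G : ℝ → ℝ := fun τ => W τ - w / 4 * τ + (w / 4 * s₁ - w) with hG
  have hGder : ∀ τ ∈ Ioo (-1 : ℝ) 1, HasDerivAt G (deriv W τ - w / 4) τ := fun τ hτ => by
    simpa using (((hWder τ hτ).sub ((hasDerivAt_id τ).const_mul (w / 4))).add_const
      (w / 4 * s₁ - w)).congr_of_eventuallyEq (f₁ := G) (Filter.Eventually.of_forall fun _ => rfl)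
  have hGc : ContinuousOn G (Ioo (-1) 1) := fun τ hτ =>
    (hGder τ hτ).continuousAt.continuousWithinAt
  have hGs₁ : G s₁ = 0 := by simp only [hG, ← hw]; ring
  have hGeq : ∀ τ, G τ = W τ - w + w / 4 * (s₁ - τ) := fun τ => by simp only [hG]; ring
  have hGmid : ∀ τ ∈ Icc (-1 / 2 : ℝ) (1 / 2), 0 < G τ := by
    intro τ hτ
    have hτ1 : τ ∈ Ioo (-1 : ℝ) 1 := ⟨by linarith [hτ.1], by linarith [hτ.2]⟩
    have h1 : lam * K ^ m ≤ W τ := by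
      refine le_trans ?_ (hWlow τ hτ1)
      have : K ≤ 1 - τ ^ 2 := hK34.trans (by nlinarith [hτ.1, hτ.2])
      gcongr
    have h2 : 0 < w / 4 * (s₁ - τ) := mul_pos (by linarith) (by linarith [hτ.2])
    rw [hGeq]
    linarith
  have hGright : ∀ τ ∈ Ico (1 / 2 : ℝ) s₁, 0 < G τ := by
    have hanti : AntitoneOn W (Icc (1 / 2) s₁) := by
      have hsub : ∀ τ ∈ Icc (1 / 2 : ℝ) s₁, τ ∈ Ioo (-1 : ℝ) 1 := fun τ hτ =>
        ⟨by linarith [hτ.1], hτ.2.trans_lt hs₁.2⟩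
      refine antitoneOn_of_deriv_nonpos (convex_Icc _ _)
        (fun τ hτ => (hWder τ (hsub τ hτ)).continuousAt.continuousWithinAt)
        (fun τ hτ => (hWder τ (hsub τ (interior_subset hτ))).differentiableAt.differentiableWithinAt)
        fun τ hτ => ?_
      rw [interior_Icc] at hτ
      exact (hWneg τ ⟨hτ.1, hτ.2.trans hs₁.2⟩).le
    intro τ hτ
    have h1 : w ≤ W τ := hanti ⟨hτ.1, hτ.2.le⟩ ⟨by linarith, le_rfl⟩ hτ.2.le
    have h2 : 0 < w / 4 * (s₁ - τ) := mul_pos (by linarith) (by linarith [hτ.2])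
    rw [hGeq]
    linarith
  obtain ⟨τ₀, hτ₀, hGτ₀⟩ : ∃ τ ∈ Ioo (-1 : ℝ) (-1 / 2), G τ < 0 := by
    have hc : ContinuousAt (fun τ : ℝ => Lam * (1 - τ ^ 2) ^ m) (-1) :=
      continuousAt_const.mul
        (ContinuousAt.rpow_const (by fun_prop) (Or.inr hm0.le))
    have hlim : Filter.Tendsto (fun τ : ℝ => Lam * (1 - τ ^ 2) ^ m)
        (nhdsWithin (-1) (Ioi (-1))) (nhds 0) := by
      have := hc.tendsto.mono_left (nhdsWithin_le_nhds (s := Ioi (-1)))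
      simpa [Real.zero_rpow hm0.ne'] using this
    obtain ⟨τ, hτ1, hτ2⟩ := ((hlim.eventually_lt_const (half_pos hw0)).and
      (Ioo_mem_nhdsGT (by norm_num : (-1 : ℝ) < -1 / 2))).exists
    refine ⟨τ, hτ2, ?_⟩
    have h1 := hWup τ ⟨hτ2.1, by linarith [hτ2.2]⟩
    have h2 : w / 4 * (s₁ - τ) ≤ w / 4 * 2 :=
      mul_le_mul_of_nonneg_left (by linarith [hs₁.2, hτ2.1]) (by linarith)
    rw [hGeq]
    linarith
  have hIcc : ∀ x ∈ Icc τ₀ (-1 / 2), Icc x (-1 / 2) ⊆ Ioo (-1 : ℝ) 1 := fun x hx y hy =>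
    ⟨hτ₀.1.trans_le (hx.1.trans hy.1), by linarith [hy.2]⟩
  have hGhalf : 0 < G (-1 / 2) := hGmid _ ⟨le_rfl, by norm_num⟩
  have hτ₀m : τ₀ ∈ Icc τ₀ (-1 / 2) := ⟨le_rfl, hτ₀.2.le⟩
  obtain ⟨s₀, ⟨hs₀m, hGs₀⟩, hs₀max⟩ : ∃ s, IsGreatest (Icc τ₀ (-1 / 2) ∩ G ⁻¹' {0}) s := by
    refine IsCompact.exists_isGreatest ?_ ?_
    · exact isCompact_Icc.of_isClosed_subset
        ((hGc.mono (hIcc _ hτ₀m)).preimage_isClosed_of_isClosed isClosed_Icc isClosed_singleton)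
        inter_subset_left
    · obtain ⟨z, hz, hz0⟩ := intermediate_value_Icc hτ₀.2.le (hGc.mono (hIcc _ hτ₀m))
        ⟨hGτ₀.le, hGhalf.le⟩
      exact ⟨z, hz, hz0⟩
  have hGs₀' : G s₀ = 0 := hGs₀
  have hs₀half : s₀ < -1 / 2 := lt_of_le_of_ne hs₀m.2 fun heq => by
    rw [heq] at hGs₀'
    linarith
  have hs₀1 : -1 < s₀ := hτ₀.1.trans_le hs₀m.1
  have hs₀I : s₀ ∈ Ioo (-1 : ℝ) 1 := ⟨hs₀1, by linarith⟩
  have hGpos : ∀ τ ∈ Ioo s₀ s₁, 0 < G τ := by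
    intro τ hτ
    rcases le_or_gt (1 / 2) τ with h1 | h1
    · exact hGright τ ⟨h1, hτ.2⟩
    rcases le_or_gt (-1 / 2) τ with h2 | h2
    · exact hGmid τ ⟨h2, h1.le⟩
    by_contra! hneg
    have hτm : τ ∈ Icc τ₀ (-1 / 2) := ⟨hs₀m.1.trans hτ.1.le, h2.le⟩
    obtain ⟨z, hz, hz0⟩ := intermediate_value_Icc h2.le (hGc.mono (hIcc _ hτm)) ⟨hneg, hGhalf.le⟩
    have : z ≤ s₀ := hs₀max ⟨⟨hτm.1.trans hz.1, hz.2⟩, hz0⟩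
    linarith [hz.1, hτ.1]
  have hslope₀ : 0 < deriv W s₀ - w / 4 := by
    have hδ := hsq _ hs₀I
    set δ : ℝ := 1 - s₀ ^ 2 with hδdef
    have hδm := Real.rpow_pos_of_pos hδ (m - 1)
    have hpow : δ ^ m = δ ^ (m - 1) * δ := by
      rw [← Real.rpow_add_one hδ.ne', sub_add_cancel]
    have hWs₀ : W s₀ = w - w / 4 * (s₁ - s₀) := by linarith [hGeq s₀]
    have h1 : w / 2 ≤ W s₀ := by
      have : w / 4 * (s₁ - s₀) ≤ w / 4 * 2 :=
        mul_le_mul_of_nonneg_left (by linarith [hs₁.2]) (by linarith)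
      linarith
    have h2 : W s₀ ≤ w := by
      have : 0 ≤ w / 4 * (s₁ - s₀) := mul_nonneg (by linarith) (by linarith)
      linarith
    have hδK : δ < K := by
      by_contra! hle
      have h3 : lam * K ^ m ≤ lam * δ ^ m := by gcongr
      linarith [hWlow _ hs₀I]
    have hLK : Lam * K = 3 / 4 * lam := by rw [hK]; field_simp
    have h4 : Lam * δ < lam := by nlinarith
    have h5 : w / 2 ≤ δ ^ (m - 1) * (Lam * δ) := by
      have := hWup _ hs₀I
      rw [← hδdef, hpow] at this
      linarith
    have h6 := mul_lt_mul_of_pos_left h4 hδm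
    linarith [hWpos s₀ ⟨hs₀1, hs₀half⟩]
  have hslope₁ : deriv W s₁ - w / 4 < 0 := by
    linarith [hWneg s₁ ⟨by linarith, hs₁.2⟩]
  obtain ⟨a, b, U, U', ha, hb, hUm, hmono, hder, hc, hnn, hUa, hUb, hU0, hU'a, hU'b, heq, hode⟩ :=
    exists_profile_between_simple_zeros (G := G) (G' := fun τ => deriv W τ - w / 4) hp
      (by linarith : s₀ < 0) (by linarith : 0 < s₁)
      (fun s hs => hGder s ⟨hs₀1.trans_le hs.1, hs.2.trans_lt hs₁.2⟩)
      hGpos hGs₀' hGs₁ hslope₀ hslope₁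
  exact ⟨w / 4, by linarith, w / 4 * s₁ - w, a, b, s₀, s₁, U, U', ha, hb, ⟨hs₀1, by linarith⟩,
    ⟨le_rfl, hs₁.2⟩, hUm, hmono, hder, hc, hnn, hUa, hUb, hU0, hU'a, hU'b, hGpos, heq, hode⟩
end
end
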